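/- arXiv:2410.06751 — 7 statements merged into one kernel-verified Lean document; each statement's English description precedes it below -/
import Mathlib

section
/- Let T_1, …, T_k be trees, let G be a group acting on each T_i by graph automorphisms, and let g, h ∈ G be elements such that for each i at least one of g, h is loxodromic on T_i. Then there exist integers m, n with 1 ≤ m, n ≤ (2k)^k·(2k+1) such that the element g^m·h^n is loxodromic on every T_i. -/
/-- An element `g` of a group `G` acting (via `φ`) by graph automorphisms on a graph `T`
is loxodromic if it fixes no vertex and does not swap the two endpoints of any edge
(i.e. it is not elliptic). -/
def IsLoxodromic {V G : Type*} [Group G] (T : SimpleGraph V)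
    (φ : G →* Equiv.Perm V) (g : G) : Prop :=
  (∀ v : V, φ g v ≠ v) ∧ ∀ u v : V, T.Adj u v → ¬(φ g u = v ∧ φ g v = u)

/-- The combinatorial properties of the distance function of a simplicial tree. -/
structure IsTreeMetric {V : Type*} (d : V → V → ℕ) : Prop where
  eq_zero_iff : ∀ a b, d a b = 0 ↔ a = b
  comm : ∀ a b, d a b = d b a
  triangle : ∀ a b c, d a c ≤ d a b + d b c
  four_point : ∀ x y z w, d x y + d z w ≤ d x z + d y w ∨ d x y + d z w ≤ d x w + d y z
  ne_of_eq_one : ∀ a b w, d a b = 1 → d w a ≠ d w b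
  exists_geodesic : ∀ a b, ∃ γ : ℕ → V, γ 0 = a ∧ γ (d a b) = b ∧
    ∀ i j, i ≤ j → j ≤ d a b → d (γ i) (γ j) + i = j

namespace SimpleGraph

variable {V : Type*} {T : SimpleGraph V}

/-- In a tree, a geodesic from `x` to `y` is contained in the union of geodesics from a third
vertex to `x` and `y`. -/
theorem IsTree.dist_add_dist_or (hT : T.IsTree) {x y m : V}
    (hm : T.dist x m + T.dist m y = T.dist x y) (b : V) :
    T.dist x m + T.dist m b = T.dist x b ∨ T.dist b m + T.dist m y = T.dist b y := by
  classical
  have hc := hT.connected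
  obtain ⟨p, hp⟩ := hc.exists_walk_length_eq_dist x m
  obtain ⟨q, hq⟩ := hc.exists_walk_length_eq_dist m y
  obtain ⟨r, hr⟩ := hc.exists_walk_length_eq_dist x b
  obtain ⟨s, hs⟩ := hc.exists_walk_length_eq_dist b y
  have hpq : (p.append q).IsPath :=
    Walk.isPath_of_length_eq_dist _ (by rw [Walk.length_append]; omega)
  have heq : p.append q = (r.append s).bypass :=
    congrArg Subtype.val ((hT.isAcyclic.subsingleton_path x y).elim
      ⟨_, hpq⟩ ⟨_, Walk.bypass_isPath _⟩)
  have hmem : m ∈ (r.append s).support := by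
    apply Walk.support_bypass_subset_support
    rw [← heq, Walk.mem_support_append_iff]
    exact Or.inl p.end_mem_support
  rw [Walk.mem_support_append_iff] at hmem
  have split : ∀ {u v : V} (t : T.Walk u v), t.length = T.dist u v → m ∈ t.support →
      T.dist u m + T.dist m v = T.dist u v := by
    intro u v t ht h
    have h1 := congrArg Walk.length (t.take_spec h)
    rw [Walk.length_append] at h1
    have h2 := dist_le (t.takeUntil m h)
    have h3 := dist_le (t.dropUntil m h)
    have h4 := hc.dist_triangle (u := u) (v := m) (w := v)
    omega
  exact hmem.imp (split r hr) (split s hs)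

theorem Connected.exists_geodesic (hT : T.Connected) (a b : V) :
    ∃ γ : ℕ → V, γ 0 = a ∧ γ (T.dist a b) = b ∧
      ∀ i j, i ≤ j → j ≤ T.dist a b → T.dist (γ i) (γ j) + i = j := by
  obtain ⟨p, hp⟩ := hT.exists_walk_length_eq_dist a b
  refine ⟨p.getVert, p.getVert_zero, hp ▸ p.getVert_length, fun i j hij hj => ?_⟩
  have h1 := dist_le (p.take i)
  have h2 := dist_le (p.drop j)
  have h3 : ∀ n, T.dist (p.getVert i) (p.getVert (i + n)) ≤ n := by
    intro n
    have h := dist_le ((p.drop i).take n)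
    rw [Walk.take_length, Walk.drop_getVert] at h
    omega
  have h3 := h3 (j - i)
  rw [Nat.add_sub_cancel' hij] at h3
  rw [Walk.take_length] at h1
  rw [Walk.drop_length] at h2
  have h4 := hT.dist_triangle (u := a) (v := p.getVert i) (w := b)
  have h5 := hT.dist_triangle (u := p.getVert i) (v := p.getVert j) (w := b)
  omega

/-- Distances from a vertex of a tree to a geodesic are controlled by a projection point. -/
theorem IsTree.exists_projection (hT : T.IsTree) {γ : ℕ → V} {L : ℕ}
    (hγ : ∀ i j, i ≤ j → j ≤ L → T.dist (γ i) (γ j) + i = j) (w : V) :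
    ∃ p η : ℕ, p ≤ L ∧ ∀ i ≤ L, T.dist w (γ i) = η + (i - p) + (p - i) := by
  obtain ⟨p, hpL, hp⟩ := Finset.exists_min_image (Finset.range (L + 1))
    (fun i => T.dist w (γ i)) ⟨0, by simp⟩
  simp only [Finset.mem_range] at hpL hp
  have key : ∀ i q, q ≤ L → i ≤ L → T.dist (γ p) (γ q) = 1 →
      T.dist (γ p) (γ q) + T.dist (γ q) (γ i) = T.dist (γ p) (γ i) →
      T.dist w (γ i) = T.dist w (γ p) + T.dist (γ p) (γ i) := by
    intro i q hq hi h1 h2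
    have h3 := hT.dist_add_dist_or h2 w
    have h4 := hp q (by omega)
    have h5 := hT.dist_ne_of_adj w (dist_eq_one_iff_adj.1 h1)
    have h6 := hT.connected.dist_triangle (u := w) (v := γ p) (w := γ q)
    have := T.dist_comm (u := γ p) (v := w)
    have := T.dist_comm (u := γ q) (v := w)
    omega
  refine ⟨p, T.dist w (γ p), by omega, fun i hi => ?_⟩
  rcases lt_trichotomy i p with h | rfl | h
  · have h1 := hγ i p h.le (by omega)
    have h2 := hγ i (p - 1) (by omega) (by omega)
    have h3 := hγ (p - 1) p (by omega) (by omega)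
    rw [T.dist_comm] at h1 h2 h3
    have := key i (p - 1) (by omega) hi (by omega) (by omega)
    omega
  · omega
  · have h1 := hγ p i h.le (by omega)
    have h2 := hγ (p + 1) i (by omega) (by omega)
    have h3 := hγ p (p + 1) (by omega) (by omega)
    have := key i (p + 1) (by omega) hi (by omega) (by omega)
    omega

theorem IsTree.isTreeMetric_dist (hT : T.IsTree) : IsTreeMetric T.dist where
  eq_zero_iff _ _ := hT.connected.dist_eq_zero_iff
  comm _ _ := T.dist_comm
  triangle _ _ _ := hT.connected.dist_triangle
  ne_of_eq_one _ _ w h := hT.dist_ne_of_adj w (dist_eq_one_iff_adj.1 h)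
  exists_geodesic := hT.connected.exists_geodesic
  four_point x y z w := by
    obtain ⟨γ, h0, hL, hγ⟩ := hT.connected.exists_geodesic x y
    obtain ⟨p, η, hp, hz⟩ := hT.exists_projection hγ z
    obtain ⟨q, θ, hq, hw⟩ := hT.exists_projection hγ w
    have h1 := hz 0 (by omega)
    have h2 := hz _ le_rfl
    have h3 := hw 0 (by omega)
    have h4 := hw _ le_rfl
    have h5 := hz q hq
    have h6 := hw q hq
    rw [h0] at h1 h3
    rw [hL] at h2 h4
    have h7 := hT.connected.dist_triangle (u := z) (v := γ q) (w := w)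
    rw [T.dist_comm (u := γ q)] at h7
    rw [T.dist_comm (u := x) (v := z), T.dist_comm (u := x) (v := w),
      T.dist_comm (u := y) (v := z), T.dist_comm (u := y) (v := w)]
    omega

/-- The adjacency-preserving permutations of a connected graph are isometries. -/
theorem Connected.dist_perm (hT : T.Connected) (f : Equiv.Perm V)
    (hf : ∀ u v, T.Adj u v ↔ T.Adj (f u) (f v)) (u v : V) : T.dist (f u) (f v) = T.dist u v := by
  have le : ∀ (e : T ≃g T) (u v : V), T.dist (e u) (e v) ≤ T.dist u v := by
    intro e u v
    obtain ⟨p, hp⟩ := hT.exists_walk_length_eq_dist u v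
    have := dist_le (p.map e.toHom)
    rw [Walk.length_map, hp] at this
    exact this
  let e : T ≃g T := ⟨f, fun {a b} => (hf a b).symm⟩
  refine le_antisymm (le e u v) ?_
  have := le e.symm (e u) (e v)
  rwa [e.symm_apply_apply, e.symm_apply_apply] at this

end SimpleGraph

/-- A bi-infinite geodesic. -/
def IsLine {V : Type*} (d : V → V → ℕ) (A : ℤ → V) : Prop :=
  ∀ i j, d (A i) (A j) = (i - j).natAbs

/-- The map `f` reverses an edge of the line `A` and does not move it forward along `A`. -/
def FlipsBack {V : Type*} (A : ℤ → V) (f : V → V) : Prop :=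
  ∃ i c : ℤ, c ≤ 2 * i + 1 ∧ f (A i) = A (c - i) ∧ f (A (i + 1)) = A (c - i - 1)

namespace IsTreeMetric

variable {V : Type*} {d : V → V → ℕ} {A : ℤ → V}

theorem pos_of_ne (hd : IsTreeMetric d) {a b : V} (h : a ≠ b) : 0 < d a b :=
  Nat.pos_of_ne_zero fun h0 => h ((hd.eq_zero_iff a b).1 h0)

theorem between_trans (hd : IsTreeMetric d) {a b m e : V} (h1 : d a b + d b m = d a m)
    (h2 : d b m + d m e = d b e) (hne : b ≠ m) : d a m + d m e = d a e := by
  have h3 := hd.four_point a m b e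
  have h4 := hd.triangle a m e
  have h5 := hd.pos_of_ne hne
  have := hd.comm m b
  omega

theorem eq_of_between (hd : IsTreeMetric d) {a b m m' : V} (h : d a m + d m b = d a b)
    (h' : d a m' + d m' b = d a b) (heq : d a m = d a m') : m = m' := by
  have h3 := hd.four_point a b m m'
  have := hd.comm m b
  have := hd.comm m' b
  exact (hd.eq_zero_iff _ _).1 (by omega)

theorem dist_eq_add_one_of_ne (hd : IsTreeMetric d) {a b n m : V} (h : d a n + 1 = d a b)
    (hn : d n b = 1) (hm : d b m = 1) (hne : m ≠ n) : d a m = d a b + 1 := by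
  have h1 := hd.ne_of_eq_one b m a hm
  have h2 := hd.triangle a m b
  have h3 := hd.triangle a b m
  have h4 := hd.comm m b
  by_contra h5
  exact hne (hd.eq_of_between (a := a) (b := b) (by omega) (by omega) (by omega))

theorem exists_line_projection (hd : IsTreeMetric d) (hA : IsLine d A) (w : V) :
    ∃ (p : ℤ) (η : ℕ), ∀ x, d w (A x) = η + (x - p).natAbs := by
  obtain ⟨p, hp⟩ : ∃ p, ∀ x, d w (A p) ≤ d w (A x) :=
    ⟨_, fun x => Function.argmin_le (fun x => d w (A x)) x⟩
  have key : ∀ x q, (p - q).natAbs = 1 → (p - q).natAbs + (q - x).natAbs = (p - x).natAbs →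
      d w (A x) = d w (A p) + (x - p).natAbs := by
    intro x q h1 h2
    have h3 := hp q
    have h4 := hA p q
    have h5 := hd.ne_of_eq_one (A p) (A q) w (by omega)
    have h6 := hd.triangle w (A p) (A q)
    have h7 := hd.between_trans (a := w) (b := A p) (m := A q) (e := A x)
      (by omega) (by simp only [hA _ _]; omega)
      (fun h => by have := (hd.eq_zero_iff _ _).2 h; omega)
    rw [hA q x] at h7
    omega
  refine ⟨p, d w (A p), fun x => ?_⟩
  rcases lt_trichotomy x p with h | rfl | h
  · exact key x (p - 1) (by omega) (by omega)
  · simp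
  · exact key x (p + 1) (by omega) (by omega)

/-- Two lines in a tree are either joined by a bridge or share two vertices. -/
theorem bridge_or_overlap (hd : IsTreeMetric d) (hA : IsLine d A) {B : ℤ → V}
    (hB : IsLine d B) :
    (∃ (p q : ℤ) (D : ℕ), ∀ x y, d (A x) (B y) = (x - p).natAbs + D + (y - q).natAbs) ∨
      ∃ y y' x x', y < y' ∧ B y = A x ∧ B y' = A x' := by
  choose π η hπ using fun y => hd.exists_line_projection hA (B y)
  by_cases hconst : ∀ y, π y = π 0
  · left
    obtain ⟨q, D, hq⟩ := hd.exists_line_projection hB (A (π 0))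
    refine ⟨π 0, q, D, fun x y => ?_⟩
    have h1 := hπ y x
    have h2 := hπ y (π 0)
    have h3 := hq y
    rw [hd.comm (A _) (B _)] at h3 ⊢
    rw [hconst y] at h1 h2
    omega
  · right
    push Not at hconst
    have hmem : ∀ y y', π y ≠ π y' → ∃ z, B z = A (π y) ∧ (z - y).natAbs = η y ∧
        (z - y').natAbs = η y' + (π y - π y').natAbs := by
      intro y y' hne
      have h1 := hπ y (π y)
      have h2 := hπ y' (π y)
      have h3 := hπ y (π y')
      have h4 := hπ y' (π y')
      have h5 := hA (π y) (π y')
      have h6 := hd.comm (B y') (A (π y))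
      have h6' := hd.comm (B y') (A (π y'))
      have h7 := hd.between_trans (a := B y) (b := A (π y)) (m := A (π y')) (e := B y')
        (by omega) (by omega) (fun h => by have := (hd.eq_zero_iff _ _).2 h; omega)
      have h8 := hB y y'
      rcases le_total y y' with h | h
      · refine ⟨y + η y, ?_, by omega, by omega⟩
        have h9 := hB y (y + η y)
        have h10 := hB (y + η y) y'
        exact hd.eq_of_between (a := B y) (b := B y') (by omega) (by omega) (by omega)
      · refine ⟨y - η y, ?_, by omega, by omega⟩
        have h9 := hB y (y - η y)
        have h10 := hB (y - η y) y'
        exact hd.eq_of_between (a := B y) (b := B y') (by omega) (by omega) (by omega)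
    obtain ⟨y, hy⟩ := hconst
    obtain ⟨z, hz, -, -⟩ := hmem y 0 hy
    obtain ⟨z', hz', -, -⟩ := hmem 0 y hy.symm
    rcases lt_trichotomy z z' with h | rfl | h
    · exact ⟨z, z', _, _, h, hz, hz'⟩
    · have h1 := hA (π y) (π 0)
      have := (hd.eq_zero_iff (A (π y)) (A (π 0))).2 (hz.symm.trans hz')
      omega
    · exact ⟨z', z, _, _, h, hz', hz⟩

/-- If the geodesic from `x` to `f x` continues to `f u` while `u ≠ x` is on it, then `f` moves
`x` along an axis. -/
theorem eq_of_elliptic (hd : IsTreeMetric d) {f : V → V} (hf : ∀ u v, d (f u) (f v) = d u v)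
    (hell : ∀ x, d x (f (f x)) ≤ d x (f x)) {x u : V} (h1 : d x u + d u (f x) = d x (f x))
    (h2 : d x (f x) + d x u = d x (f u)) : x = u := by
  by_contra hne
  have h3 := hd.pos_of_ne hne
  have h4 := hf x u
  have h5 := hf u (f x)
  have h6 := hf x (f x)
  have h7 := hd.between_trans (a := x) (b := f x) (m := f u) (e := f (f x)) (by omega) (by omega)
    (fun h => by have := (hd.eq_zero_iff _ _).2 h; omega)
  have := hell x
  omega

theorem eq_zero_of_translates_edge (hd : IsTreeMetric d) (hA : IsLine d A) {f : V → V}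
    (hf : ∀ u v, d (f u) (f v) = d u v) (hell : ∀ x, d x (f (f x)) ≤ d x (f x)) {y s : ℤ}
    (h0 : f (A y) = A (y + s)) (h1 : f (A (y + 1)) = A (y + 1 + s)) : s = 0 := by
  have hne : A y ≠ A (y + 1) := fun h => by
    have := (hd.eq_zero_iff _ _).2 h
    rw [hA] at this
    omega
  rcases lt_trichotomy s 0 with h | h | h
  · refine absurd (hd.eq_of_elliptic hf hell (x := A (y + 1)) (u := A y) ?_ ?_).symm hne <;>
      simp only [h0, h1, hA _ _] <;> omega
  · exact h
  · refine absurd (hd.eq_of_elliptic hf hell (x := A y) (u := A (y + 1)) ?_ ?_) hne <;>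
      simp only [h0, h1, hA _ _] <;> omega

theorem extend_flip (hd : IsTreeMetric d) (hA : IsLine d A) {f : V → V}
    (hf : ∀ u v, d (f u) (f v) = d u v) (hell : ∀ x, d x (f (f x)) ≤ d x (f x)) {x c : ℤ}
    (h0 : f (A x) = A (c - x)) (h1 : f (A (x + 1)) = A (c - x - 1)) :
    ∃ x', c ≤ 2 * x' + 2 ∧ f (A x') = A (c - x') ∧ f (A (x' + 1)) = A (c - x' - 1) := by
  obtain ⟨n, hn⟩ : ∃ n : ℕ, c - 2 * x - 2 ≤ n := ⟨_, Int.self_le_toNat _⟩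
  induction n generalizing x with
  | zero => exact ⟨x, by omega, h0, h1⟩
  | succ n ih =>
    by_cases hc : c ≤ 2 * x + 2
    · exact ⟨x, hc, h0, h1⟩
    refine ih (x := x + 1) (by rw [h1]; congr 1; omega) ?_ (by push_cast at hn; omega)
    by_contra hne
    have h2 : d (A (x + 1)) (f (A (x + 1 + 1))) = d (A (x + 1)) (A (c - x - 1)) + 1 := by
      refine hd.dist_eq_add_one_of_ne (n := A (c - (x + 1) - 1)) ?_ ?_ ?_ hne
      · simp only [hA _ _]; omega
      · simp only [hA _ _]; omega
      · rw [← h1, hf, hA]; omega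
    have h3 := hd.eq_of_elliptic hf hell (x := A (x + 1)) (u := A (x + 1 + 1))
      (by simp only [h1, hA _ _]; omega) (by rw [h2]; simp only [h1, hA _ _]; omega)
    have := (hd.eq_zero_iff _ _).2 h3
    rw [hA] at this
    omega

/-- If `f` and `τ ∘ f` are both elliptic, where `τ` translates the line `A` forward, then `f`
flips an edge of `A` backwards. -/
theorem flipsBack_of_elliptic (hd : IsTreeMetric d) (hA : IsLine d A) {f τ : V → V}
    (hf : ∀ u v, d (f u) (f v) = d u v) (hτ : ∀ u v, d (τ u) (τ v) = d u v) {R : ℤ}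
    (hR : 0 < R) (hτA : ∀ i, τ (A i) = A (i + R)) (hell : ∀ x, d x (f (f x)) ≤ d x (f x))
    (hell' : ∀ x, d x (τ (f (τ (f x)))) ≤ d x (τ (f x))) : FlipsBack A f := by
  have hτf : ∀ u v, d (τ (f u)) (τ (f v)) = d u v := fun u v => by rw [hτ, hf]
  have hAinj : ∀ {i j}, A i = A j → i = j := fun {i j} h => by
    have h := (hd.eq_zero_iff _ _).2 h
    rw [hA] at h
    omega
  have hB : IsLine d fun y => f (A y) := fun i j => by rw [hf, hA]
  rcases hd.bridge_or_overlap hA hB with ⟨p, q, D, h⟩ | ⟨y, y', x, x', hlt, hx, hx'⟩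
  · have hp : q = p := hAinj <| hd.eq_of_elliptic hf hell (x := A q) (u := A p)
      (by simp only [h, hA _ _]; omega) (by simp only [h, hA _ _]; omega)
    have h' : ∀ x y, d (A x) (τ (f (A y))) = (x - (p + R)).natAbs + D + (y - q).natAbs := by
      intro x y
      have h1 := h (x - R) y
      rw [← hτ, hτA, sub_add_cancel] at h1
      omega
    have hp' : q = p + R := hAinj <|
      hd.eq_of_elliptic hτf hell' (x := A q) (u := A (p + R))
        (by simp only [h', hA _ _]; omega) (by simp only [h', hA _ _]; omega)
    omega
  · have h1 := hB y y'
    simp only [hx, hx', hA _ _] at h1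
    have hstep : ∀ z, (x - z).natAbs = 1 → (z - x').natAbs + 1 = (x - x').natAbs →
        f (A (y + 1)) = A z := by
      intro z hz hz'
      refine hd.eq_of_between (a := A x) (b := A x') ?_ ?_ ?_
      · rw [← hx, ← hx']; simp only [hf, hA _ _]; omega
      · simp only [hA _ _]; omega
      · rw [← hx, hf, hx]; simp only [hA _ _]; omega
    rcases (by omega : x' = x + (y' - y) ∨ x' = x - (y' - y)) with hs | hs
    · have h2 := hstep (x + 1) (by omega) (by omega)
      have h3 := hd.eq_zero_of_translates_edge hA hf hell (y := y) (s := x - y)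
        (by rw [hx]; congr 1; omega) (by rw [h2]; congr 1; omega)
      have h4 := hd.eq_zero_of_translates_edge hA hτf hell' (y := y) (s := x - y + R)
        (by rw [hx, hτA]; congr 1; omega) (by rw [h2, hτA]; congr 1; omega)
      omega
    · have h2 := hstep (x - 1) (by omega) (by omega)
      obtain ⟨z, hz, hz1, hz2⟩ := hd.extend_flip hA hτf hell' (x := y) (c := x + y + R)
        (by rw [hx, hτA]; congr 1; omega) (by rw [h2, hτA]; congr 1; omega)
      have hτinj : ∀ {u v}, τ u = τ v → u = v := fun {u v} h => by
        rwa [← hd.eq_zero_iff, hτ, hd.eq_zero_iff] at h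
      refine ⟨z, x + y, by omega, hτinj ?_, hτinj ?_⟩
      · rw [hz1, hτA]; congr 1; omega
      · rw [hz2, hτA]; congr 1; omega

theorem displacement_le_of_between (hd : IsTreeMetric d) {f : V → V}
    (hf : ∀ u v, d (f u) (f v) = d u v) {u v w : V} (h : d u v + d v w = d u w) :
    d v (f v) ≤ d u (f u) ∨ d v (f v) ≤ d w (f w) := by
  have h1 := hd.four_point u w v (f v)
  have h2 := hd.four_point (f u) (f w) (f v) u
  have h3 := hd.four_point (f u) (f w) (f v) w
  have h4 := hd.triangle u (f u) (f w)
  have h5 := hd.triangle w (f w) (f u)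
  simp only [hf] at *
  have := hd.comm (f v) u
  have := hd.comm (f v) w
  have := hd.comm (f u) u
  have := hd.comm (f u) w
  have := hd.comm (f w) u
  have := hd.comm (f w) w
  have := hd.comm w v
  have := hd.comm w u
  have := hd.comm v u
  omega

/-- The displacement, along the line `A`, of a map flipping an edge of `A` backwards. -/
theorem displacement_of_flip (hd : IsTreeMetric d) (hA : IsLine d A) {f : V → V}
    (hf : ∀ u v, d (f u) (f v) = d u v) {i c : ℤ} (hc : c ≤ 2 * i + 1)
    (h0 : f (A i) = A (c - i)) (h1 : f (A (i + 1)) = A (c - i - 1)) {x : ℤ}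
    (hx : i ≤ x ∨ x ≤ c - i) : d (A x) (f (A x)) = (2 * x - c).natAbs := by
  have hAne : ∀ {j k}, j ≠ k → A j ≠ A k := fun {j k} hne h => by
    have h := (hd.eq_zero_iff _ _).2 h
    rw [hA] at h
    omega
  have e0 : d (f (A x)) (A (c - i)) = (x - i).natAbs := by rw [← h0, hf, hA]
  have e1 : d (f (A x)) (A (c - i - 1)) = (x - (i + 1)).natAbs := by rw [← h1, hf, hA]
  rw [hd.comm] at e0 e1
  have a0 := hA x (c - i)
  have a1 := hA x (c - i - 1)
  have a2 := hA (c - i) (c - i - 1)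
  have a3 := hd.comm (A (c - i)) (A (c - i - 1))
  have hne : A (c - i) ≠ A (c - i - 1) := hAne (by omega)
  by_cases hx1 : i + 1 ≤ x
  · have := hd.between_trans (a := A x) (b := A (c - i)) (m := A (c - i - 1)) (e := f (A x))
      (by omega) (by omega) hne
    omega
  by_cases hx2 : x ≤ c - i - 1
  · have := hd.between_trans (a := A x) (b := A (c - i - 1)) (m := A (c - i)) (e := f (A x))
      (by omega) (by omega) hne.symm
    omega
  rcases (by omega : x = i ∨ x = c - i) with rfl | rfl
  · rw [h0, hA]; omega
  · rw [← h0, hf, h0, hA]; omega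

/-- Two commuting maps flipping edges of `A` backwards flip them about the same center. -/
theorem flip_center_eq_of_commute (hd : IsTreeMetric d) (hA : IsLine d A) {p q : V → V}
    (hp : ∀ u v, d (p u) (p v) = d u v) (hcomm : ∀ x, p (q x) = q (p x))
    (hq : ∀ u v, d (q u) (q v) = d u v) {i c i' c' : ℤ}
    (hc : c ≤ 2 * i + 1) (h1 : p (A i) = A (c - i)) (h2 : p (A (i + 1)) = A (c - i - 1))
    (hc' : c' ≤ 2 * i' + 1) (h2' : q (A (i' + 1)) = A (c' - i' - 1)) (hi : i ≤ i') :
    c = c' := by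
  have hdis : ∀ x, (i ≤ x ∨ x ≤ c - i) → d (A x) (p (A x)) = (2 * x - c).natAbs :=
    fun x => hd.displacement_of_flip hA hp hc h1 h2
  have hinv : d (A (i' + 1)) (p (A (i' + 1))) =
      d (A (c' - i' - 1)) (p (A (c' - i' - 1))) := by
    rw [← h2', hcomm, hq]
  rw [hdis _ (by omega)] at hinv
  by_cases hx : i ≤ c' - i' - 1 ∨ c' - i' - 1 ≤ c - i
  · rw [hdis _ hx] at hinv
    omega
  · have h3 := hd.displacement_le_of_between hp (u := A (c - i)) (v := A (c' - i' - 1))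
      (w := A i) (by simp only [hA _ _]; omega)
    rw [hdis i (by omega), hdis (c - i) (by omega)] at h3
    omega

theorem eq_of_flip_of_commute (hd : IsTreeMetric d) (hA : IsLine d A) {p q : V → V}
    (hp : ∀ u v, d (p u) (p v) = d u v) (hq : ∀ u v, d (q u) (q v) = d u v)
    (hcomm : ∀ x, p (q x) = q (p x)) {i i' c : ℤ}
    (hc : c ≤ 2 * i + 1) (h1 : p (A i) = A (c - i)) (h2 : p (A (i + 1)) = A (c - i - 1))
    (h1' : q (A i') = A (c - i')) (h2' : q (A (i' + 1)) = A (c - i' - 1)) (hi : i ≤ i') :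
    q (A i) = A (c - i) ∧ q (A (i + 1)) = A (c - i - 1) := by
  obtain ⟨n, rfl⟩ := Int.le.dest hi
  induction n with
  | zero => simpa using And.intro h1' h2'
  | succ n ih =>
    push_cast at h1' h2' hi
    set z := i + n with hz
    rw [← add_assoc, ← hz] at h1' h2' hi
    have hdone : q (A z) = A (c - z) → q (A i) = A (c - i) ∧ q (A (i + 1)) = A (c - i - 1) := by
      intro h
      exact ih h (by rw [h1']; congr 1; omega) (by omega)
    apply hdone
    by_cases hinvn : c = 2 * z + 1
    · have : i = z := by omega
      rw [this] at h1 h2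
      have e1 : c - z = z + 1 := by omega
      have e2 : c - (z + 1) = z := by omega
      have e3 : c - z - 1 = z := by omega
      rw [e1] at h1 ⊢
      rw [e2] at h1'
      rw [e3] at h2
      rw [← h2, ← hcomm, h1', h1]
    by_contra hne
    have hdis : ∀ x, (i ≤ x ∨ x ≤ c - i) → d (A x) (p (A x)) = (2 * x - c).natAbs :=
      fun x => hd.displacement_of_flip hA hp hc h1 h2
    have hinv : ∀ x, d (q x) (p (q x)) = d x (p x) := fun x => by rw [hcomm, hq]
    have e1 : d (A i) (q (A z)) = d (A i) (A (c - (z + 1))) + 1 := by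
      refine hd.dist_eq_add_one_of_ne (n := A (c - z)) ?_ ?_ ?_ hne
      · simp only [hA _ _]; omega
      · simp only [hA _ _]; omega
      · rw [← h1', hq, hA]; omega
    have e2 : d (A (c - (z + 1))) (q (A z)) = 1 := by rw [← h1', hq, hA]; omega
    have e3 : d (A (c - (z + 1))) (q (A i)) = (z + 1 - i).natAbs := by rw [← h1', hq, hA]
    have e4 : d (q (A z)) (q (A i)) = (z - i).natAbs := by rw [hq, hA]
    have e5 := hd.between_trans (a := A i) (b := A (c - (z + 1))) (m := q (A z)) (e := q (A i))
      (by omega) (by omega) (fun h => by have := (hd.eq_zero_iff _ _).2 h; omega)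
    have e6 := hd.displacement_le_of_between hp (u := A i) (v := A (c - (z + 1)))
      (w := q (A i)) (by omega)
    rw [← h1', hinv, hinv, hdis _ (by omega), hdis _ (by omega)] at e6
    omega

/-- Commuting maps that flip edges of `A` backwards agree on some edge of `A`. -/
theorem exists_eq_of_flipsBack (hd : IsTreeMetric d) (hA : IsLine d A) {p q : V → V}
    (hp : ∀ u v, d (p u) (p v) = d u v) (hq : ∀ u v, d (q u) (q v) = d u v)
    (hcomm : ∀ x, p (q x) = q (p x)) (hpA : FlipsBack A p) (hqA : FlipsBack A q) :
    ∃ i, p (A i) = q (A i) ∧ p (A (i + 1)) = q (A (i + 1)) := by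
  obtain ⟨i, c, hc, h1, h2⟩ := hpA
  obtain ⟨i', c', hc', h1', h2'⟩ := hqA
  have hcc : c = c' := by
    rcases le_total i i' with hi | hi
    · exact hd.flip_center_eq_of_commute hA hp hcomm hq hc h1 h2 hc' h2' hi
    · exact (hd.flip_center_eq_of_commute hA hq (fun x => (hcomm x).symm) hp hc' h1' h2' hc h2
        hi).symm
  subst hcc
  rcases le_total i i' with hi | hi
  · obtain ⟨e1, e2⟩ := hd.eq_of_flip_of_commute hA hp hq hcomm hc h1 h2 h1' h2' hi
    exact ⟨i, by rw [h1, e1], by rw [h2, e2]⟩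
  · obtain ⟨e1, e2⟩ := hd.eq_of_flip_of_commute hA hq hp (fun x => (hcomm x).symm) hc' h1' h2'
      h1 h2 hi
    exact ⟨i', by rw [h1', e1], by rw [h2', e2]⟩

/-- A map fixing an edge of `A` does not flip another one backwards. -/
theorem not_flipsBack_of_fixes_edge (hA : IsLine d A) {f : V → V}
    (hf : ∀ u v, d (f u) (f v) = d u v) {a : ℤ} (h0 : f (A a) = A a)
    (h1 : f (A (a + 1)) = A (a + 1)) : ¬ FlipsBack A f := by
  rintro ⟨i, c, -, h2, h3⟩
  have e1 := hf (A i) (A a)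
  have e2 := hf (A i) (A (a + 1))
  have e3 := hf (A (i + 1)) (A a)
  have e4 := hf (A (i + 1)) (A (a + 1))
  rw [h0, h2, hA, hA] at e1
  rw [h1, h2, hA, hA] at e2
  rw [h0, h3, hA, hA] at e3
  rw [h1, h3, hA, hA] at e4
  omega

/-- A local geodesic in a tree is a geodesic. -/
theorem isLine_of_local (hd : IsTreeMetric d) (h1 : ∀ i, d (A i) (A (i + 1)) = 1)
    (h2 : ∀ i, A (i + 2) ≠ A i) : IsLine d A := by
  have key : ∀ (n : ℕ) i, d (A i) (A (i + n)) = n ∧ d (A i) (A (i + n + 1)) = n + 1 := by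
    intro n i
    induction n with
    | zero => simpa using And.intro ((hd.eq_zero_iff _ _).2 rfl) (h1 i)
    | succ n ih =>
      have h3 := hd.dist_eq_add_one_of_ne (a := A i) (b := A (i + n + 1)) (n := A (i + n))
        (m := A (i + n + 2)) (by omega) (h1 _) (by rw [← h1 (i + n + 1)]; congr 2; ring) (h2 _)
      push_cast
      rw [← add_assoc]
      refine ⟨ih.2, ?_⟩
      rw [ih.2] at h3
      rw [← h3]; congr 2; ring
  intro i j
  rcases le_total i j with h | h
  · obtain ⟨n, rfl⟩ := Int.le.dest h
    rw [(key n i).1]; omega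
  · obtain ⟨n, rfl⟩ := Int.le.dest h
    rw [hd.comm, (key n j).1]; omega

theorem dist_le_of_swap (hd : IsTreeMetric d) {f : V → V} (hf : ∀ u v, d (f u) (f v) = d u v)
    {u v : V} (huv : d u v ≤ 1) (hu : f u = v) (hv : f v = u) (x : V) :
    d x (f (f x)) ≤ d x (f x) := by
  have h1 : d (f x) v = d x u := by rw [← hf x u, hu]
  have h2 : d (f x) u = d x v := by rw [← hf x v, hv]
  have h3 : d (f (f x)) u = d x u := by rw [← h1, ← hf (f x) v, hv]
  have h4 : d (f (f x)) v = d x v := by rw [← h2, ← hf (f x) u, hu]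
  have h5 := hd.triangle x u (f (f x))
  have h6 := hd.triangle x v (f (f x))
  have h7 := hd.comm u (f (f x))
  have h8 := hd.comm v (f (f x))
  rcases (by omega : d u v = 0 ∨ d u v = 1) with h | h
  · obtain rfl := (hd.eq_zero_iff _ _).1 h
    have h9 := hd.four_point x (f (f x)) (f x) u
    rw [hf, hd.comm (f x) x] at h9
    omega
  · have h9 := hd.ne_of_eq_one u v x h
    have h10 := hd.four_point x u (f x) v
    have h11 := hd.four_point x v (f x) u
    have := hd.comm u (f x)
    have := hd.comm v (f x)
    have := hd.comm v u
    omega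

theorem dist_zpow (f : Equiv.Perm V) (hf : ∀ u v, d (f u) (f v) = d u v) (k : ℤ) (u v : V) :
    d ((f ^ k) u) ((f ^ k) v) = d u v := by
  induction k with
  | zero => simp
  | succ n ih => rw [add_comm, zpow_add, zpow_one, Equiv.Perm.mul_apply, Equiv.Perm.mul_apply,
      hf, ih]
  | pred n ih =>
    rw [← ih, sub_eq_neg_add, zpow_add, zpow_neg_one, Equiv.Perm.mul_apply,
      Equiv.Perm.mul_apply, ← hf]
    simp

/-- A tree isometry without fixed vertices and inversions translates a line. -/
theorem exists_axis (hd : IsTreeMetric d) [Nonempty V] (f : Equiv.Perm V)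
    (hf : ∀ u v, d (f u) (f v) = d u v) (hfix : ∀ v, f v ≠ v)
    (hinv : ∀ u v, d u v = 1 → ¬ (f u = v ∧ f v = u)) :
    ∃ (A : ℤ → V) (l : ℤ), 0 < l ∧ IsLine d A ∧ ∀ i, f (A i) = A (i + l) := by
  obtain ⟨x, hx⟩ : ∃ x, ∀ y, d x (f x) ≤ d y (f y) :=
    ⟨_, fun y => Function.argmin_le (fun y => d y (f y)) y⟩
  obtain ⟨γ, hγ0, hγl, hγ⟩ := hd.exists_geodesic x (f x)
  have hl : 0 < d x (f x) := hd.pos_of_ne (hfix x).symm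
  set l := d x (f x) with hldef
  let A : ℤ → V := fun i => (f ^ (i / l)) (γ (i % l).toNat)
  have hper : ∀ i k : ℤ, A (i + l * k) = (f ^ k) (A i) := by
    intro i k
    simp only [A]
    rw [Int.add_mul_ediv_left _ _ (by omega), Int.add_mul_emod_self_left, add_comm (i / _),
      zpow_add, Equiv.Perm.mul_apply]
  have hstep : ∀ i, f (A i) = A (i + l) := fun i => by simpa using (hper i 1).symm
  have hAlt : ∀ r : ℕ, r < l → A r = γ r := by
    intro r hr
    simp only [A]
    rw [Int.ediv_eq_zero_of_lt (by omega) (by omega), Int.emod_eq_of_lt (by omega) (by omega)]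
    simp
  have hAle : ∀ r : ℕ, r ≤ l → A r = γ r := by
    intro r hr
    rcases hr.lt_or_eq with h | rfl
    · exact hAlt r h
    · have h1 := hstep 0
      rw [zero_add, show (0 : ℤ) = ((0 : ℕ) : ℤ) from rfl, hAlt 0 hl, hγ0] at h1
      rw [← h1, hγl]
  have hred : ∀ i : ℤ, ∃ (r : ℕ) (k : ℤ), r < l ∧ i = r + l * k := fun i =>
    ⟨(i % l).toNat, i / l, by have := Int.emod_lt_of_pos i (b := l) (by omega); omega, by
      have := Int.emod_nonneg i (b := l) (by omega)
      rw [Int.toNat_of_nonneg this, Int.emod_add_mul_ediv]⟩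
  refine ⟨A, l, by omega, hd.isLine_of_local (fun i => ?_) (fun i => ?_), hstep⟩
  · obtain ⟨r, k, hr, rfl⟩ := hred i
    rw [add_right_comm, hper, hper, dist_zpow f hf, hAle r hr.le,
      show ((r : ℤ) + 1) = ((r + 1 : ℕ) : ℤ) by push_cast; rfl, hAle (r + 1) hr]
    have := hγ r (r + 1) (by omega) (by omega)
    omega
  · obtain ⟨r, k, hr, rfl⟩ := hred i
    rw [add_right_comm, hper, hper]
    refine (f ^ k).injective.ne ?_
    by_cases hr2 : r + 2 ≤ l
    · rw [show ((r : ℤ) + 2) = ((r + 2 : ℕ) : ℤ) by push_cast; rfl, hAle _ hr2, hAle r hr.le]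
      intro h
      have := hγ r (r + 2) (by omega) (by omega)
      have := (hd.eq_zero_iff _ _).2 h
      rw [hd.comm] at this
      omega
    · have hr1 : l = r + 1 := by omega
      rw [show ((r : ℤ) + 2) = ((1 : ℕ) : ℤ) + l by rw [hr1]; push_cast; ring, ← hstep,
        hAle 1 (by omega), hAle r hr.le]
      intro h
      have h01 := hγ 0 1 (by omega) (by omega)
      have h1r := hγ r l (by omega) (by omega)
      by_cases hl1 : l = 1
      · have hr0 : r = 0 := by omega
        subst hr0
        refine hinv (γ 0) (γ 1) (by omega) ⟨?_, h⟩
        rw [hγ0, ← hγl, hl1]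
      · have h2 := hx (γ 1)
        have h3 := hγ 1 r (by omega) (by omega)
        rw [h] at h2
        omega

end IsTreeMetric

section Action

variable {V G : Type*} [Group G] {T : SimpleGraph V} {φ : G →* Equiv.Perm V}

theorem not_isLoxodromic_iff (hT : T.IsTree) {g : G} :
    ¬ IsLoxodromic T φ g ↔ ∃ u v, T.dist u v ≤ 1 ∧ φ g u = v ∧ φ g v = u := by
  have hd := hT.isTreeMetric_dist
  rw [IsLoxodromic, not_and_or]
  simp only [not_forall, not_not]
  constructor
  · rintro (⟨v, hv⟩ | ⟨u, v, hadj, h⟩)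
    · exact ⟨v, v, by simp, hv, hv⟩
    · exact ⟨u, v, (SimpleGraph.dist_eq_one_iff_adj.2 hadj).le, h⟩
  · rintro ⟨u, v, huv, h⟩
    rcases (by omega : T.dist u v = 0 ∨ T.dist u v = 1) with h0 | h1
    · obtain rfl := (hd.eq_zero_iff _ _).1 h0
      exact Or.inl ⟨u, h.1⟩
    · exact Or.inr ⟨u, v, SimpleGraph.dist_eq_one_iff_adj.1 h1, h⟩

theorem not_isLoxodromic_of_swap (hT : T.IsTree) {g : G} {u v : V} (huv : T.dist u v ≤ 1)
    (hu : φ g u = v) (hv : φ g v = u) : ¬ IsLoxodromic T φ g :=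
  (not_isLoxodromic_iff hT).2 ⟨u, v, huv, hu, hv⟩

theorem not_isLoxodromic_pow (hT : T.IsTree) {g : G} (hg : ¬ IsLoxodromic T φ g) (n : ℕ) :
    ¬ IsLoxodromic T φ (g ^ n) := by
  obtain ⟨u, v, huv, hu, hv⟩ := (not_isLoxodromic_iff hT).1 hg
  have key : (φ (g ^ n) u = u ∧ φ (g ^ n) v = v) ∨ (φ (g ^ n) u = v ∧ φ (g ^ n) v = u) := by
    induction n with
    | zero => simp
    | succ n ih =>
      simp only [pow_succ', map_mul, Equiv.Perm.mul_apply]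
      rcases ih with ⟨h1, h2⟩ | ⟨h1, h2⟩ <;> simp only [h1, h2, hu, hv, and_self, true_or, or_true]
  rcases key with ⟨h1, -⟩ | ⟨h1, h2⟩
  · exact not_isLoxodromic_of_swap hT (by simp) h1 h1
  · exact not_isLoxodromic_of_swap hT huv h1 h2

theorem not_isLoxodromic_mul_comm (hT : T.IsTree)
    (hφ : ∀ (a : G) (u v : V), T.Adj u v ↔ T.Adj (φ a u) (φ a v)) {a b : G}
    (h : ¬ IsLoxodromic T φ (a * b)) : ¬ IsLoxodromic T φ (b * a) := by
  obtain ⟨u, v, huv, hu, hv⟩ := (not_isLoxodromic_iff hT).1 h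
  refine not_isLoxodromic_of_swap hT (u := φ b u) (v := φ b v) ?_ ?_ ?_
  · rwa [hT.connected.dist_perm _ (hφ b)]
  · rw [map_mul, Equiv.Perm.mul_apply] at hu ⊢
    rw [hu]
  · rw [map_mul, Equiv.Perm.mul_apply] at hv ⊢
    rw [hv]

theorem dist_le_of_not_isLoxodromic (hT : T.IsTree)
    (hφ : ∀ (a : G) (u v : V), T.Adj u v ↔ T.Adj (φ a u) (φ a v)) {g : G}
    (hg : ¬ IsLoxodromic T φ g) (x : V) :
    T.dist x (φ g (φ g x)) ≤ T.dist x (φ g x) := by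
  obtain ⟨u, v, huv, hu, hv⟩ := (not_isLoxodromic_iff hT).1 hg
  exact hT.isTreeMetric_dist.dist_le_of_swap (hT.connected.dist_perm _ (hφ g)) huv hu hv x

theorem IsLoxodromic.exists_axis (hT : T.IsTree)
    (hφ : ∀ (a : G) (u v : V), T.Adj u v ↔ T.Adj (φ a u) (φ a v)) {g : G}
    (hg : IsLoxodromic T φ g) :
    ∃ (A : ℤ → V) (l : ℤ), 0 < l ∧ IsLine T.dist A ∧
      ∀ (n : ℕ) i, φ (g ^ n) (A i) = A (i + n * l) := by
  have := hT.connected.nonempty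
  obtain ⟨A, l, hl, hA, h⟩ := hT.isTreeMetric_dist.exists_axis (φ g)
    (hT.connected.dist_perm _ (hφ g)) hg.1
    (fun u v huv => hg.2 u v (SimpleGraph.dist_eq_one_iff_adj.1 huv))
  refine ⟨A, l, hl, hA, fun n => ?_⟩
  induction n with
  | zero => simp
  | succ n ih =>
    intro i
    rw [pow_succ', map_mul, Equiv.Perm.mul_apply, ih, h]
    congr 1
    push_cast
    ring

/-- A set of naturals containing no positive multiple of a positive difference of two of its
elements. -/
def DifferenceFree (F : Set ℕ) : Prop :=
  ∀ x ∈ F, ∀ y ∈ F, x < y → ∀ t, 1 ≤ t → t * (y - x) ∉ F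

theorem differenceFree_empty : DifferenceFree ∅ := fun _ hx => hx.elim

theorem differenceFree_flipsBack (hT : T.IsTree)
    (hφ : ∀ (a : G) (u v : V), T.Adj u v ↔ T.Adj (φ a u) (φ a v)) {A : ℤ → V}
    (hA : IsLine T.dist A) (h : G) :
    DifferenceFree {n | FlipsBack A (φ (h ^ n))} := by
  intro x hx y hy hxy t _ ht
  have hiso := fun a : G => hT.connected.dist_perm _ (hφ a)
  obtain ⟨i, h0, h1⟩ := hT.isTreeMetric_dist.exists_eq_of_flipsBack hA (hiso _) (hiso _)
    (fun z => by
      rw [← Equiv.Perm.mul_apply, ← map_mul, ← Equiv.Perm.mul_apply, ← map_mul,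
        pow_mul_comm]) hx hy
  have fixed : ∀ z, φ (h ^ x) z = φ (h ^ y) z → φ (h ^ (t * (y - x))) z = z := by
    intro z hz
    have hs : φ (h ^ (y - x)) z = z := by
      apply (φ (h ^ x)).injective
      rw [← Equiv.Perm.mul_apply, ← map_mul, ← pow_add, Nat.add_sub_cancel' hxy.le, hz]
    rw [mul_comm, pow_mul, map_pow]
    exact Function.IsFixedPt.perm_pow hs t
  exact IsTreeMetric.not_flipsBack_of_fixes_edge hA (hiso _) (fixed _ h0) (fixed _ h1) ht

theorem flipsBack_of_not_isLoxodromic (hT : T.IsTree)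
    (hφ : ∀ (a : G) (u v : V), T.Adj u v ↔ T.Adj (φ a u) (φ a v)) {A : ℤ → V}
    (hA : IsLine T.dist A) {a b : G} {R : ℤ} (hR : 0 < R)
    (hb : ∀ i, φ b (A i) = A (i + R)) (ha : ¬ IsLoxodromic T φ a)
    (hba : ¬ IsLoxodromic T φ (b * a)) : FlipsBack A (φ a) :=
  hT.isTreeMetric_dist.flipsBack_of_elliptic hA (hT.connected.dist_perm _ (hφ a))
    (hT.connected.dist_perm _ (hφ b)) hR hb (dist_le_of_not_isLoxodromic hT hφ ha)
    (fun x => by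
      have := dist_le_of_not_isLoxodromic hT hφ hba x
      simpa only [map_mul, Equiv.Perm.mul_apply] using this)

theorem exists_differenceFree (hT : T.IsTree)
    (hφ : ∀ (a : G) (u v : V), T.Adj u v ↔ T.Adj (φ a u) (φ a v)) {g h : G}
    (hgh : IsLoxodromic T φ g ∨ IsLoxodromic T φ h) :
    ∃ F F' : Set ℕ, DifferenceFree F ∧ DifferenceFree F' ∧
      ∀ n, 1 ≤ n → n ∉ F → ∀ m m', m ∉ F' → m' ∉ F' → m < m' →
        ¬ IsLoxodromic T φ (g ^ m * h ^ n) → IsLoxodromic T φ (g ^ m' * h ^ n) := by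
  by_cases hg : IsLoxodromic T φ g
  · obtain ⟨A, l, hl, hA, htr⟩ := hg.exists_axis hT hφ
    refine ⟨_, ∅, differenceFree_flipsBack hT hφ hA h, differenceFree_empty,
      fun n _ hnF m m' _ _ hmm hm => ?_⟩
    by_contra hm'
    rw [← Nat.sub_add_cancel hmm.le, pow_add, mul_assoc] at hm'
    have hpos : 0 < ((m' - m : ℕ) : ℤ) := by omega
    obtain ⟨i, c, hc, h0, h1⟩ :=
      flipsBack_of_not_isLoxodromic hT hφ hA (mul_pos hpos hl) (htr _) hm hm'
    have hml : 0 ≤ (m : ℤ) * l := by positivity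
    refine hnF ⟨i, c - m * l, by omega, ?_, ?_⟩
    · apply (φ (g ^ m)).injective
      rw [← Equiv.Perm.mul_apply, ← map_mul, h0, htr]
      congr 1
      ring
    · apply (φ (g ^ m)).injective
      rw [← Equiv.Perm.mul_apply, ← map_mul, h1, htr]
      congr 1
      ring
  · obtain ⟨A, l, hl, hA, htr⟩ := (hgh.resolve_left hg).exists_axis hT hφ
    refine ⟨∅, _, differenceFree_empty, differenceFree_flipsBack hT hφ hA g,
      fun n hn _ m _ hmF _ _ hm => (hmF ?_).elim⟩
    have hpos : 0 < (n : ℤ) := by omega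
    exact flipsBack_of_not_isLoxodromic hT hφ hA (mul_pos hpos hl) (htr _)
      (not_isLoxodromic_pow hT hg m) (not_isLoxodromic_mul_comm hT hφ hm)

end Action

theorem exists_dilation {ι : Type*} [Fintype ι] (F : ι → Set ℕ)
    (hF : ∀ i, DifferenceFree (F i)) (N : ℕ) (hN : Fintype.card ι ≤ N) :
    ∃ D, 1 ≤ D ∧ D ≤ N ^ Fintype.card ι ∧
      ∀ i t t', 1 ≤ t → t < t' → t' ≤ N + 1 → D * t ∈ F i → D * t' ∉ F i := by
  classical
  have key : ∀ (S : Finset ι) (D : ℕ), 1 ≤ D → (∀ i, i ∉ S → ∀ t, 1 ≤ t → D * t ∉ F i) →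
      ∃ D', 1 ≤ D' ∧ D' ≤ D * N ^ S.card ∧
        ∀ i t t', 1 ≤ t → t < t' → t' ≤ N + 1 → D' * t ∈ F i → D' * t' ∉ F i := by
    intro S
    induction S using Finset.strongInduction with
    | H S ih =>
      intro D hD hS
      by_cases hgood : ∀ i t t', 1 ≤ t → t < t' → t' ≤ N + 1 → D * t ∈ F i → D * t' ∉ F i
      · refine ⟨D, hD, Nat.le_mul_of_pos_right _ ?_, hgood⟩
        rcases N.eq_zero_or_pos with rfl | hpos
        · have := S.card_le_univ
          simp [show S.card = 0 by omega]
        · positivity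
      · push Not at hgood
        obtain ⟨i, t, t', ht, htt, htN, h1, h2⟩ := hgood
        have hi : i ∈ S := by
          by_contra hi
          exact hS i hi t ht h1
        have hs : 1 ≤ t' - t := by omega
        obtain ⟨D', hD', hle, hres⟩ := ih (S.erase i) (Finset.erase_ssubset hi) (D * (t' - t))
          (Nat.mul_pos hD hs) (fun j hj s hs1 => by
            rcases eq_or_ne j i with rfl | hji
            · rw [mul_comm _ s, Nat.mul_sub]
              exact hF j _ h1 _ h2 (Nat.mul_lt_mul_of_pos_left htt hD) s hs1
            · rw [mul_assoc]
              exact hS j (fun hjS => hj (Finset.mem_erase.2 ⟨hji, hjS⟩)) _ (Nat.mul_pos hs hs1))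
        refine ⟨D', hD', hle.trans ?_, hres⟩
        rw [← Finset.card_erase_add_one hi, pow_succ', ← mul_assoc]
        gcongr
        omega
  simpa using key Finset.univ 1 le_rfl (fun i hi => (hi (Finset.mem_univ i)).elim)

theorem exists_avoiding {ι : Type*} [Fintype ι] (B : ι → Set ℕ) (N : ℕ)
    (hN : Fintype.card ι < N)
    (hB : ∀ i t t', 1 ≤ t → t < t' → t' ≤ N → t ∈ B i → t' ∉ B i) :
    ∃ t, 1 ≤ t ∧ t ≤ N ∧ ∀ i, t ∉ B i := by
  by_contra! hcon
  have hcon' : ∀ t : Fin N, ∃ i, (t : ℕ) + 1 ∈ B i := fun t => hcon _ (by omega) (by omega)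
  choose c hc using hcon'
  obtain ⟨s, t, hst, heq⟩ := Fintype.exists_ne_map_eq_of_card_lt c (by simpa using hN)
  wlog hlt : s < t generalizing s t
  · exact this t s hst.symm heq.symm (lt_of_le_of_ne (not_lt.1 hlt) hst.symm)
  have hlt' : (s : ℕ) < t := hlt
  exact hB (c s) (s + 1) (t + 1) (by omega) (by omega) (by omega) (hc s) (heq ▸ hc t)

/-- **Theorem A.1 (SimulSupport).** If a group `G` acts on trees `T_1, …, T_k` by graph
automorphisms, and `g, h ∈ G` are such that for each `i` at least one of `g, h` is
loxodromic on `T_i`, then there exist `1 ≤ m, n ≤ (2k)^k (2k+1)` such that `g^m h^n`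
is loxodromic on every `T_i`. -/
theorem simultaneous_loxodromics_on_trees {G : Type*} [Group G] {k : ℕ}
    (V : Fin k → Type*) (T : ∀ i, SimpleGraph (V i)) (hT : ∀ i, (T i).IsTree)
    (φ : ∀ i, G →* Equiv.Perm (V i))
    (hφ : ∀ (i) (a : G) (u v : V i), (T i).Adj u v ↔ (T i).Adj (φ i a u) (φ i a v))
    (g h : G)
    (hgh : ∀ i, IsLoxodromic (T i) (φ i) g ∨ IsLoxodromic (T i) (φ i) h) :
    ∃ m n : ℕ, 1 ≤ m ∧ m ≤ (2 * k) ^ k * (2 * k + 1) ∧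
      1 ≤ n ∧ n ≤ (2 * k) ^ k * (2 * k + 1) ∧
      ∀ i, IsLoxodromic (T i) (φ i) (g ^ m * h ^ n) := by
  choose F F' hF hF' hmain using fun i => exists_differenceFree (hT i) (hφ i) (hgh i)
  have hcard : Fintype.card (Fin k) ≤ 2 * k := by rw [Fintype.card_fin]; omega
  obtain ⟨D, hD1, hD, hDF⟩ := exists_dilation F hF (2 * k) hcard
  obtain ⟨E, hE1, hE, hEF⟩ := exists_dilation F' hF' (2 * k) hcard
  rw [Fintype.card_fin] at hD hE
  obtain ⟨t, ht1, ht, htF⟩ := exists_avoiding (fun i => {t | D * t ∈ F i}) (2 * k + 1)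
    (by omega) hDF
  obtain ⟨s, hs1, hs, hsB⟩ := exists_avoiding
    (Sum.elim (fun i => {s | E * s ∈ F' i})
      (fun i => {s | E * s ∉ F' i ∧ ¬ IsLoxodromic (T i) (φ i) (g ^ (E * s) * h ^ (D * t))}))
    (2 * k + 1) (by simp only [Fintype.card_sum, Fintype.card_fin]; omega) (by
      rintro (i | i) s s' hs hss hs' h1 h2
      · exact hEF i s s' hs hss hs' h1 h2
      · exact h2.2 (hmain i _ (Nat.mul_pos hD1 ht1) (htF i) _ _ h1.1 h2.1
          (Nat.mul_lt_mul_of_pos_left hss hE1) h1.2))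
  refine ⟨E * s, D * t, Nat.mul_pos hE1 hs1, Nat.mul_le_mul hE hs, Nat.mul_pos hD1 ht1,
    Nat.mul_le_mul hD ht, fun i => ?_⟩
  by_contra hcon
  exact hsB (Sum.inr i) ⟨hsB (Sum.inl i), hcon⟩
end

section
/- Let G be a group acting on a tree T by graph automorphisms. Suppose that for every ray r in T, the ascending chain of pointwise G-stabilizers of the tails of r is eventually constant. If G is not elliptic on T (i.e., G fixes no vertex and leaves no edge invariant), then G contains a finitely generated subgroup that is not elliptic on T. -/
/-- A subgroup `H` of a group `G` acting (via `φ`) by graph automorphisms on a graph `T`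
is elliptic if it has a global fixed vertex or a globally invariant edge. -/
def IsEllipticSubgroup {V G : Type*} [Group G] (T : SimpleGraph V)
    (φ : G →* Equiv.Perm V) (H : Subgroup G) : Prop :=
  (∃ v : V, ∀ g ∈ H, φ g v = v) ∨
  (∃ u v : V, T.Adj u v ∧
    ∀ g ∈ H, (φ g u = u ∧ φ g v = v) ∨ (φ g u = v ∧ φ g v = u))

namespace SimpleGraph

variable {V : Type*} {T : SimpleGraph V} {a b v x y z : V}

lemma Connected.exists_dist_eq_of_le_dist (hT : T.Connected) {k : ℕ} (hk : k ≤ T.dist a b) :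
    ∃ y, T.dist a y = k ∧ T.dist a y + T.dist y b = T.dist a b := by
  obtain ⟨p, hp⟩ := hT.exists_walk_length_eq_dist a b
  have h₁ := dist_le (p.take k)
  have h₂ := dist_le (p.drop k)
  have h₃ := hT.dist_triangle (u := a) (v := p.getVert k) (w := b)
  rw [Walk.take_length] at h₁
  rw [Walk.drop_length] at h₂
  exact ⟨p.getVert k, by omega, by omega⟩

lemma IsTree.eq_of_dist_add_dist_eq (hT : T.IsTree)
    (hy : T.dist a y + T.dist y b = T.dist a b) (hz : T.dist a z + T.dist z b = T.dist a b)
    (hyz : T.dist a y = T.dist a z) : y = z := by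
  obtain ⟨p₁, hp₁⟩ := hT.connected.exists_walk_length_eq_dist a y
  obtain ⟨p₂, hp₂⟩ := hT.connected.exists_walk_length_eq_dist y b
  obtain ⟨q₁, hq₁⟩ := hT.connected.exists_walk_length_eq_dist a z
  obtain ⟨q₂, hq₂⟩ := hT.connected.exists_walk_length_eq_dist z b
  have hp : (p₁.append p₂).IsPath := Walk.isPath_of_length_eq_dist _ (by
    rw [Walk.length_append]; omega)
  have hq : (q₁.append q₂).IsPath := Walk.isPath_of_length_eq_dist _ (by
    rw [Walk.length_append]; omega)
  have h : p₁.append p₂ = q₁.append q₂ := (hT.existsUnique_path a b).unique hp hq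
  have h₁ : (p₁.append p₂).getVert (T.dist a y) = y := by simp [Walk.getVert_append, hp₁]
  have h₂ : (q₁.append q₂).getVert (T.dist a z) = z := by simp [Walk.getVert_append, hq₁]
  rw [← h₁, h, hyz, h₂]

lemma IsTree.dist_add_dist_eq_of_dist_le (hT : T.IsTree)
    (hy : T.dist a y + T.dist y b = T.dist a b) (hz : T.dist a z + T.dist z b = T.dist a b)
    (hyz : T.dist a y ≤ T.dist a z) : T.dist a y + T.dist y z = T.dist a z := by
  obtain ⟨w, hw, hwz⟩ := hT.connected.exists_dist_eq_of_le_dist hyz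
  have h₁ := hT.connected.dist_triangle (u := a) (v := w) (w := b)
  have h₂ := hT.connected.dist_triangle (u := w) (v := z) (w := b)
  obtain rfl : w = y := hT.eq_of_dist_add_dist_eq (by omega) hy hw
  exact hwz

/-- A nonempty geodesically convex set of vertices of a tree has a projection of every vertex. -/
lemma IsTree.exists_dist_add_dist_eq_of_convex (hT : T.IsTree) {S : Set V} (hS : S.Nonempty)
    (hconv : ∀ x ∈ S, ∀ y ∈ S, ∀ z, T.dist x z + T.dist z y = T.dist x y → z ∈ S) (v : V) :
    ∃ p ∈ S, ∀ x ∈ S, T.dist v p + T.dist p x = T.dist v x := by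
  obtain ⟨p, hpS, hp⟩ : ∃ p ∈ S, ∀ x ∈ S, T.dist v p ≤ T.dist v x :=
    ⟨_, Function.argminOn_mem (T.dist v) S hS, fun x hx => Function.argminOn_le (T.dist v) S hx⟩
  refine ⟨p, hpS, ?_⟩
  suffices h : ∀ n, ∀ x ∈ S, T.dist p x = n → T.dist v p + n = T.dist v x from
    fun x hx => h _ x hx rfl
  intro n
  induction n using Nat.strong_induction_on with
  | _ n ih =>
    intro x hx hpx
    rcases n with _ | n
    · rw [hT.connected.dist_eq_zero_iff.1 hpx, add_zero]
    obtain ⟨y, hy, hyx⟩ := hT.connected.exists_dist_eq_of_le_dist (T := T) (a := p) (b := x)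
      (k := n) (by omega)
    have hyS := hconv p hpS x hx y hyx
    have hvy := ih n (by omega) y hyS hy
    have hadj : T.Adj y x := dist_eq_one_iff_adj.1 (by omega)
    rcases hT.dist_eq_dist_add_one_of_adj v hadj with h | h
    · exfalso
      rcases n with _ | n
      · have := hp x hx
        omega
      obtain ⟨z, hz, hzy⟩ := hT.connected.exists_dist_eq_of_le_dist (T := T) (a := p) (b := y)
        (k := n) (by omega)
      have hvz := ih n (by omega) z (hconv p hpS y hyS z hzy) hz
      have hyx₁ := dist_eq_one_iff_adj.2 hadj.symm
      obtain rfl : z = x := hT.eq_of_dist_add_dist_eq (a := v) (b := y)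
        (by omega) (by omega) (by omega)
      omega
    · omega

lemma Connected.dist_apply (hT : T.Connected) {f : Equiv.Perm V}
    (hf : ∀ u v, T.Adj u v ↔ T.Adj (f u) (f v)) (u v : V) :
    T.dist (f u) (f v) = T.dist u v := by
  have key (g : T →g T) (u v : V) : T.dist (g u) (g v) ≤ T.dist u v := by
    obtain ⟨p, hp⟩ := hT.exists_walk_length_eq_dist u v
    simpa [hp] using dist_le (p.map g)
  refine le_antisymm (key ⟨f, fun h => (hf _ _).1 h⟩ u v) ?_
  simpa using key ⟨f.symm, fun {a b} h => (hf _ _).2 (by simpa using h)⟩ (f u) (f v)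

lemma IsTree.apply_eq_of_dist_add_dist_eq (hT : T.IsTree) {f : Equiv.Perm V}
    (hf : ∀ u v, T.Adj u v ↔ T.Adj (f u) (f v)) (hx : f x = x) (hy : f y = y)
    (hz : T.dist x z + T.dist z y = T.dist x y) : f z = z := by
  have h₁ := hT.connected.dist_apply hf x z
  have h₂ := hT.connected.dist_apply hf z y
  rw [hx] at h₁
  rw [hy] at h₂
  exact hT.eq_of_dist_add_dist_eq (by omega) hz h₁

lemma IsTree.eq_and_eq_of_dist_eq (hT : T.IsTree) {u u' v v' : V} (huv : T.Adj u v)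
    (huv' : T.Adj u' v') (h₁ : T.dist u u' = T.dist v v') (h₂ : T.dist u v' = T.dist v u')
    (h₃ : T.dist v u' = T.dist u u' + 1) : u = u' ∧ v = v' := by
  suffices h : T.dist u u' = 0 from
    ⟨hT.connected.dist_eq_zero_iff.1 h, hT.connected.dist_eq_zero_iff.1 (h₁ ▸ h)⟩
  by_contra h
  have hd := dist_eq_one_iff_adj.2 huv
  have hd' := dist_eq_one_iff_adj.2 huv'
  simp only [T.dist_comm (u := u) (v := u'), T.dist_comm (u := v) (v := u'),
    T.dist_comm (u := v) (v := v'), T.dist_comm (u := u) (v := v')] at *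
  have := hT.dist_add_dist_eq_of_dist_le (a := u') (b := v) (y := v') (z := u)
    (by omega) (by omega) (by omega)
  omega

/-- An automorphism of a tree that inverts an edge preserves no other edge. -/
lemma IsTree.eq_edge_of_inverts (hT : T.IsTree) {f : Equiv.Perm V}
    (hf : ∀ u v, T.Adj u v ↔ T.Adj (f u) (f v)) {u u' v v' : V} (huv : T.Adj u v)
    (huv' : T.Adj u' v') (hu : f u = v)
    (h : (f u' = u' ∧ f v' = v') ∨ (f u' = v' ∧ f v' = u')) :
    (u = u' ∧ v = v') ∨ (u = v' ∧ v = u') := by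
  have hd := hT.connected.dist_apply hf
  rcases h with ⟨hu', -⟩ | ⟨hu', hv'⟩
  · have h := hd u u'
    rw [hu, hu', T.dist_comm, T.dist_comm (u := u)] at h
    exact absurd h.symm (hT.dist_ne_of_adj u' huv)
  · have h₁ := hd u u'
    have h₂ := hd u v'
    rw [hu, hu'] at h₁
    rw [hu, hv'] at h₂
    have h₃ := hT.dist_eq_dist_add_one_of_adj u' huv
    rw [T.dist_comm, T.dist_comm (u := u') (v := v)] at h₃
    rcases h₃ with h₃ | h₃
    · exact Or.inr (hT.eq_and_eq_of_dist_eq huv huv'.symm h₂.symm h₁.symm (by omega))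
    · exact Or.inl (hT.eq_and_eq_of_dist_eq huv huv' h₁.symm h₂.symm h₃)

/-- If vertices `p i` lie successively on geodesics from `v` and tend to infinity, they determine
a ray from `v`. -/
lemma IsTree.exists_ray_of_dist_add_dist_eq (hT : T.IsTree) {p : ℕ → V}
    (hp : ∀ i j, i ≤ j → T.dist v (p i) + T.dist (p i) (p j) = T.dist v (p j))
    (hle : ∀ i, i ≤ T.dist v (p i)) :
    ∃ r : ℕ → V, Function.Injective r ∧ (∀ n, T.Adj (r n) (r (n + 1))) ∧
      (∀ n, T.dist v (r n) = n) ∧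
      ∀ m j, m ≤ j → T.dist v (r m) + T.dist (r m) (p j) = T.dist v (p j) := by
  choose r hr hrp using fun m => hT.connected.exists_dist_eq_of_le_dist (hle m)
  have hrp' (m j : ℕ) (hmj : m ≤ j) :
      T.dist v (r m) + T.dist (r m) (p j) = T.dist v (p j) := by
    have h₁ := hp m j hmj
    have h₂ := hrp m
    have h₃ := hT.connected.dist_triangle (u := r m) (v := p m) (w := p j)
    have h₄ := hT.connected.dist_triangle (u := v) (v := r m) (w := p j)
    omega
  refine ⟨r, fun m n h => by rw [← hr m, h, hr n], fun n => ?_, hr, hrp'⟩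
  have h := hT.dist_add_dist_eq_of_dist_le (hrp' n (n + 1) n.le_succ) (hrp (n + 1))
    (by rw [hr, hr]; omega)
  rw [hr, hr] at h
  exact dist_eq_one_iff_adj.1 (by omega)

end SimpleGraph

lemma Subgroup.FG.sup_zpowers {G : Type*} [Group G] {H : Subgroup G} (hH : H.FG) (g : G) :
    (H ⊔ Subgroup.zpowers g).FG :=
  hH.sup ⟨{g}, by rw [Finset.coe_singleton, Subgroup.zpowers_eq_closure]⟩

section

variable {V G : Type*} [Group G] {T : SimpleGraph V} {φ : G →* Equiv.Perm V}

lemma isEllipticSubgroup_top_of_not_fixed (hT : T.IsTree)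
    (hφ : ∀ (a : G) (u v : V), T.Adj u v ↔ T.Adj (φ a u) (φ a v))
    (hell : ∀ H : Subgroup G, H.FG → IsEllipticSubgroup T φ H)
    {H : Subgroup G} (hH : H.FG) (hfix : ¬ ∃ v : V, ∀ g ∈ H, φ g v = v) :
    IsEllipticSubgroup T φ ⊤ := by
  obtain ⟨u, v, huv, hinv⟩ := (hell H hH).resolve_left hfix
  obtain ⟨f, hf, hfu⟩ : ∃ f ∈ H, φ f u = v := by
    by_contra! h
    exact hfix ⟨u, fun g hg => by grind⟩
  refine Or.inr ⟨u, v, huv, fun g _ => ?_⟩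
  have hle : H ≤ H ⊔ Subgroup.zpowers g := le_sup_left
  have hg : g ∈ H ⊔ Subgroup.zpowers g :=
    Subgroup.mem_sup_right (Subgroup.mem_zpowers g)
  obtain ⟨u', v', huv', hinv'⟩ := (hell _ (hH.sup_zpowers g)).resolve_left
    fun ⟨x, hx⟩ => hfix ⟨x, fun k hk => hx k (hle hk)⟩
  have hg' := hinv' g hg
  rcases hT.eq_edge_of_inverts (hφ f) huv huv' hfu (hinv' f (hle hf)) with
    ⟨rfl, rfl⟩ | ⟨rfl, rfl⟩
  · exact hg'
  · exact hg'.imp And.symm And.symm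

lemma exists_fixed_vertex_of_forall_fg (hT : T.IsTree)
    (hφ : ∀ (a : G) (u v : V), T.Adj u v ↔ T.Adj (φ a u) (φ a v))
    (hstab : ∀ r : ℕ → V, Function.Injective r → (∀ n, T.Adj (r n) (r (n + 1))) →
      ∃ N : ℕ, ∀ n, N ≤ n →
        {g : G | ∀ m, n ≤ m → φ g (r m) = r m} =
          {g : G | ∀ m, N ≤ m → φ g (r m) = r m})
    (hfix : ∀ H : Subgroup G, H.FG → ∃ v : V, ∀ g ∈ H, φ g v = v) :
    ∃ v : V, ∀ g : G, φ g v = v := by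
  have := hT.connected.nonempty
  have v : V := Classical.arbitrary V
  choose! p hp hproj using fun (H : Subgroup G) (hH : H.FG) =>
    hT.exists_dist_add_dist_eq_of_convex (S := {x | ∀ g ∈ H, φ g x = x}) (hfix H hH)
      (fun x hx y hy z hz g hg =>
        hT.apply_eq_of_dist_add_dist_eq (hφ g) (hx g hg) (hy g hg) hz) v
  have hmono {H K : Subgroup G} (hH : H.FG) (hK : K.FG) (hHK : H ≤ K) :
      T.dist v (p H) + T.dist (p H) (p K) = T.dist v (p K) :=
    hproj H hH _ fun g hg => hp K hK g (hHK hg)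
  by_cases hbdd : ∃ n, ∀ H : Subgroup G, H.FG → T.dist v (p H) ≤ n
  · obtain ⟨n, hn⟩ := hbdd
    obtain ⟨H, hH, hmax⟩ : ∃ H : Subgroup G, H.FG ∧
        ∀ K : Subgroup G, K.FG → T.dist v (p K) ≤ T.dist v (p H) := by
      obtain ⟨H, hH, hmin⟩ : ∃ H ∈ {H : Subgroup G | H.FG}, ∀ K ∈ {H : Subgroup G | H.FG},
          n - T.dist v (p H) ≤ n - T.dist v (p K) :=
        ⟨_, Function.argminOn_mem _ _ ⟨⊥, Subgroup.FG.bot⟩,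
          fun K hK => Function.argminOn_le (fun H => n - T.dist v (p H)) _ hK⟩
      refine ⟨H, hH, fun K hK => ?_⟩
      have := hmin K hK
      have := hn K hK
      have := hn H hH
      omega
    refine ⟨p H, fun g => ?_⟩
    have hK := hH.sup_zpowers g
    have h₁ := hmono hH hK le_sup_left
    have h₂ := hmax _ hK
    rw [hT.connected.dist_eq_zero_iff.1 (by omega : T.dist (p H) (p (H ⊔ .zpowers g)) = 0)]
    exact hp _ hK g (Subgroup.mem_sup_right (Subgroup.mem_zpowers g))
  · push Not at hbdd
    choose F hF hlt using hbdd
    have hK (i : ℕ) : (partialSups F i).FG := by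
      induction i with
      | zero => simpa using hF 0
      | succ i ih => rw [partialSups_add_one]; exact ih.sup (hF _)
    have hle (i : ℕ) : i ≤ T.dist v (p (partialSups F i)) := by
      have h₁ := hlt i
      have h₂ := hmono (hF i) (hK i) (le_partialSups F i)
      omega
    have hchain (i j : ℕ) (hij : i ≤ j) := hmono (hK i) (hK j) ((partialSups F).monotone hij)
    obtain ⟨r, hinj, hadj, hr, hrp⟩ := hT.exists_ray_of_dist_add_dist_eq hchain hle
    obtain ⟨N, hN⟩ := hstab r hinj hadj
    set i := N + 1
    set n := T.dist v (p (partialSups F i))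
    have hfixN : ∀ g ∈ partialSups F i, φ g (r N) = r N := by
      intro g hg
      have hmem : g ∈ {g : G | ∀ m, max N n ≤ m → φ g (r m) = r m} := by
        intro m hm
        have hij := hchain i (max i m) (le_max_left _ _)
        have hmj := hrp m (max i m) (le_max_right _ _)
        have h := hT.dist_add_dist_eq_of_dist_le hij hmj (by rw [hr]; omega)
        refine hT.apply_eq_of_dist_add_dist_eq (hφ g) (hp _ (hK i) g hg)
          (hp _ (hK (max i m)) g ((partialSups F).monotone (le_max_left _ _) hg)) ?_
        omega
      rw [hN _ (le_max_left _ _)] at hmem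
      exact hmem N le_rfl
    have h₁ := hproj _ (hK i) _ hfixN
    have h₂ := hle i
    rw [hr] at h₁
    omega

end

/-- **Lemma 2.12.** Let `G` act on a tree `T` by graph automorphisms. Suppose that for
every ray `r` in `T`, the ascending chain of pointwise stabilisers of the tails of `r`
is eventually constant. If `G` is not elliptic on `T`, then `G` contains a finitely
generated subgroup that is not elliptic on `T`. -/
theorem exists_fg_nonelliptic_subgroup {V G : Type*} [Group G]
    (T : SimpleGraph V) (hT : T.IsTree)
    (φ : G →* Equiv.Perm V)
    (hφ : ∀ (a : G) (u v : V), T.Adj u v ↔ T.Adj (φ a u) (φ a v))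
    (hstab : ∀ r : ℕ → V, Function.Injective r → (∀ n, T.Adj (r n) (r (n + 1))) →
      ∃ N : ℕ, ∀ n, N ≤ n →
        {g : G | ∀ m, n ≤ m → φ g (r m) = r m} =
          {g : G | ∀ m, N ≤ m → φ g (r m) = r m})
    (hG : ¬ IsEllipticSubgroup T φ (⊤ : Subgroup G)) :
    ∃ H : Subgroup G, H.FG ∧ ¬ IsEllipticSubgroup T φ H := by
  by_contra! hell
  by_cases hfix : ∀ H : Subgroup G, H.FG → ∃ v : V, ∀ g ∈ H, φ g v = v
  · obtain ⟨v, hv⟩ := exists_fixed_vertex_of_forall_fg hT hφ hstab hfix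
    exact hG (Or.inl ⟨v, fun g _ => hv g⟩)
  · push Not at hfix
    obtain ⟨H, hH, h⟩ := hfix
    exact hG (isEllipticSubgroup_top_of_not_fixed hT hφ hell hH (by push Not; exact h))
end

section
/- Let ρ : G → H be a surjective group homomorphism with finite kernel and let α, β > 0. If H is (α,β)-perfect, then G is (α/|ker ρ|, β)-perfect. -/
open Pointwise

/-- A finite subset `U` of a group has `(α,β)`-growth if `|U^n| ≥ (α|U|)^{βn}` for all
`n ≥ 1`. -/
def HasProductSetGrowth {G : Type*} [Group G] (α β : ℝ) (U : Set G) : Prop :=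
  ∀ n : ℕ, 1 ≤ n → (α * (U.ncard : ℝ)) ^ (β * (n : ℝ)) ≤ ((U ^ n).ncard : ℝ)

/-- A group `G` is `(α,β)`-perfect if every finite generating set of every finite-index
subgroup of `G` has `(α,β)`-growth. -/
def IsPerfectGrowth (α β : ℝ) (G : Type*) [Group G] : Prop :=
  ∀ K : Subgroup G, K.index ≠ 0 →
    ∀ S : Set K, S.Finite → Subgroup.closure S = ⊤ →
      HasProductSetGrowth α β S

/-- The fibres of a homomorphism with finite kernel have at most `|ker f|` elements. -/
theorem Set.Finite.ncard_le_card_ker_mul_ncard_image {G H : Type*} [Group G] [Group H]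
    (f : G →* H) [Finite f.ker] {S : Set G} (hS : S.Finite) :
    S.ncard ≤ Nat.card f.ker * (f '' S).ncard := by
  classical
  lift S to Finset G using hS
  rw [← Finset.coe_image, Set.ncard_coe_finset, Set.ncard_coe_finset]
  refine Finset.card_le_mul_card_image S _ fun b hb => ?_
  obtain ⟨a, -, rfl⟩ := Finset.mem_image.mp hb
  rw [← Nat.card_eq_finsetCard]
  refine Nat.card_le_card_of_injective
    (fun x => (⟨a⁻¹ * x.1, ?_⟩ : f.ker)) fun x y hxy => ?_
  · simp [MonoidHom.mem_ker, (Finset.mem_filter.mp x.2).2]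
  · exact Subtype.ext (mul_left_cancel (congrArg Subtype.val hxy))

/-- Restricting a homomorphism to a subgroup does not enlarge its kernel. -/
theorem MonoidHom.card_ker_subgroupMap_le {G H : Type*} [Group G] [Group H]
    (f : G →* H) [Finite f.ker] (K : Subgroup G) :
    Finite (f.subgroupMap K).ker ∧ Nat.card (f.subgroupMap K).ker ≤ Nat.card f.ker := by
  let i : (f.subgroupMap K).ker → f.ker := fun x =>
    ⟨x.1.1, congrArg Subtype.val (MonoidHom.mem_ker.mp x.2)⟩
  have hi : Function.Injective i := fun x y hxy =>
    Subtype.ext (Subtype.ext (Subtype.mk.inj hxy))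
  exact ⟨Finite.of_injective i hi, Nat.card_le_card_of_injective i hi⟩

/-- **Lemma 5.7(1) (PerfectExtends).** If `ρ : G → H` is a surjective homomorphism with
finite kernel and `H` is `(α,β)`-perfect, then `G` is `(α/|ker ρ|, β)`-perfect. -/
theorem perfectGrowth_of_surjective_finite_kernel {G H : Type*} [Group G] [Group H]
    (ρ : G →* H) (hs : Function.Surjective ρ) (hker : Finite ρ.ker)
    (α β : ℝ) (hα : 0 < α) (hβ : 0 < β)
    (hH : IsPerfectGrowth α β H) :
    IsPerfectGrowth (α / (Nat.card ρ.ker : ℝ)) β G := by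
  intro K hK S hS hgen n hn
  set φ := ρ.subgroupMap K
  obtain ⟨hfin, hcard⟩ := ρ.card_ker_subgroupMap_le K
  have hindex : (K.map ρ).index ≠ 0 := ne_zero_of_dvd_ne_zero hK (K.index_map_dvd hs)
  have hgen' : Subgroup.closure (φ '' S) = ⊤ := by
    rw [← MonoidHom.map_closure, hgen,
      Subgroup.map_top_of_surjective _ (ρ.subgroupMap_surjective K)]
  have hSφ : (S.ncard : ℝ) ≤ Nat.card ρ.ker * ((φ '' S).ncard : ℝ) := by
    exact_mod_cast (hS.ncard_le_card_ker_mul_ncard_image φ).trans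
      (Nat.mul_le_mul_right _ hcard)
  have hpos : (0 : ℝ) < Nat.card ρ.ker := by exact_mod_cast Nat.card_pos
  calc (α / (Nat.card ρ.ker : ℝ) * (S.ncard : ℝ)) ^ (β * (n : ℝ))
      ≤ (α * ((φ '' S).ncard : ℝ)) ^ (β * (n : ℝ)) := by
        refine Real.rpow_le_rpow (by positivity) ?_ (by positivity)
        rw [div_mul_eq_mul_div, div_le_iff₀ hpos]
        nlinarith
    _ ≤ (((φ '' S) ^ n).ncard : ℝ) := hH _ hindex _ (hS.image φ) hgen' n hn
    _ ≤ ((S ^ n).ncard : ℝ) := by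
        classical
        have hSn : (S ^ n).Finite := by
          lift S to Finset K using hS
          exact Finset.coe_pow S n ▸ Finset.finite_toSet _
        rw [← Set.image_pow]
        exact_mod_cast Set.ncard_image_le hSn
end

section
/- Let ρ : G → H be a surjective group homomorphism with finite kernel and let α, β > 0. If G is (α,β)-perfect, then H is (α·|ker ρ|^{1−1/β}, β)-perfect. -/
open Pointwise

/-- A group homomorphism with finite kernel has finite preimages of finite sets. -/
theorem MonoidHom.finite_preimage_of_finite_ker {A B : Type*} [Group A] [Group B] (f : A →* B)
    (hf : Function.Surjective f) [Finite f.ker] {S : Set B} (hS : S.Finite) :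
    (f ⁻¹' S).Finite :=
  hS.preimage' fun b _ => (Finite.of_equiv _ (MonoidHom.fiberEquivKerOfSurjective hf b).symm : Finite _)

/-- The preimage of a finite set under a surjective homomorphism has cardinality scaled by that of
the kernel. -/
theorem MonoidHom.ncard_preimage_of_surjective {A B : Type*} [Group A] [Group B] (f : A →* B)
    (hf : Function.Surjective f) (S : Set B) :
    (f ⁻¹' S).ncard = Nat.card f.ker * S.ncard := by
  have e : (f ⁻¹' S) ≃ f.ker × S :=
    { toFun := fun x => (⟨(Function.surjInv hf (f x))⁻¹ * x, by
        simp [MonoidHom.mem_ker, Function.surjInv_eq hf]⟩, ⟨f x, x.2⟩)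
      invFun := fun p => ⟨Function.surjInv hf p.2 * p.1, by
        simp [Function.surjInv_eq hf, f.mem_ker.1 p.1.2]⟩
      left_inv := fun x => by simp
      right_inv := fun p => by
        ext <;> simp [Function.surjInv_eq hf, f.mem_ker.1 p.1.2] }
  rw [← Nat.card_coe_set_eq, ← Nat.card_coe_set_eq, Nat.card_congr e, Nat.card_prod]

/-- The preimage of a nonempty generating set under a surjective homomorphism generates. -/
theorem MonoidHom.closure_preimage_eq_top_of_nonempty {A B : Type*} [Group A] [Group B] (f : A →* B)
    (hf : Function.Surjective f) {S : Set B} (hne : S.Nonempty) (hS : Subgroup.closure S = ⊤) :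
    Subgroup.closure (f ⁻¹' S) = ⊤ := by
  have hker : f.ker ≤ Subgroup.closure (f ⁻¹' S) := by
    intro k hk
    obtain ⟨s, hs⟩ := hne
    obtain ⟨a, rfl⟩ := hf s
    have ha : a ∈ Subgroup.closure (f ⁻¹' S) := Subgroup.subset_closure hs
    have hak : a * k ∈ Subgroup.closure (f ⁻¹' S) :=
      Subgroup.subset_closure (by simpa [f.mem_ker.1 hk] using hs)
    exact (Subgroup.mul_mem_cancel_left _ ha).1 hak
  rw [← Subgroup.comap_map_eq_self hker, f.map_closure, Set.image_preimage_eq _ hf, hS,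
    Subgroup.comap_top]

/-- Growth of the preimage of a set under a surjective homomorphism with finite kernel passes to
the set itself. -/
theorem HasProductSetGrowth.of_preimage {A B : Type*} [Group A] [Group B] (f : A →* B)
    (hf : Function.Surjective f) [Finite f.ker] {α β : ℝ} (hα : 0 < α) (hβ : 0 < β) {S : Set B}
    (hS : S.Finite) (h : HasProductSetGrowth α β (f ⁻¹' S)) :
    HasProductSetGrowth (α * (Nat.card f.ker : ℝ) ^ (1 - 1 / β)) β S := by
  intro n hn
  have hm : (1 : ℝ) ≤ Nat.card f.ker := by exact_mod_cast Nat.card_pos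
  have hfin : (S ^ n).Finite := by
    clear hn
    induction n with
    | zero => simp
    | succ n ih => simpa only [pow_succ] using ih.mul hS
  have hle : ((f ⁻¹' S) ^ n).ncard ≤ Nat.card f.ker * (S ^ n).ncard := by
    rw [← f.ncard_preimage_of_surjective hf]
    refine Set.ncard_le_ncard ?_ (f.finite_preimage_of_finite_ker hf hfin)
    rw [← Set.image_subset_iff, Set.image_pow, Set.image_preimage_eq _ hf]
  have hgrow := (h n hn).trans (Nat.cast_le (α := ℝ).2 hle)
  rw [f.ncard_preimage_of_surjective hf] at hgrow
  push_cast at hgrow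
  generalize (Nat.card f.ker : ℝ) = m at hm hgrow ⊢
  have hm0 : 0 < m := one_pos.trans_le hm
  have hn' : (1 : ℝ) ≤ n := by exact_mod_cast hn
  have hs : (0 : ℝ) ≤ S.ncard := Nat.cast_nonneg _
  refine le_of_mul_le_mul_left (le_trans ?_ hgrow) hm0
  calc m * (α * m ^ (1 - 1 / β) * S.ncard) ^ (β * n)
      = m ^ (1 + (1 - 1 / β) * (β * n)) * (α * S.ncard) ^ (β * n) := by
        rw [mul_right_comm, Real.mul_rpow (by positivity) (by positivity), ← Real.rpow_mul hm0.le,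
          Real.rpow_add hm0, Real.rpow_one]
        ring
    _ ≤ m ^ (β * n) * (α * S.ncard) ^ (β * n) := by
        have : (1 - 1 / β) * (β * n) = β * n - n := by field_simp
        gcongr
        linarith
    _ = (α * (m * S.ncard)) ^ (β * n) := by
        rw [← Real.mul_rpow (by positivity) (by positivity), mul_left_comm]

/-- **Lemma 5.7(2) (PerfectExtends).** If `ρ : G → H` is a surjective homomorphism with
finite kernel and `G` is `(α,β)`-perfect, then `H` is `(α·|ker ρ|^{1−1/β}, β)`-perfect. -/
theorem perfectGrowth_of_quotient_finite_kernel {G H : Type*} [Group G] [Group H]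
    (ρ : G →* H) (hs : Function.Surjective ρ) (hker : Finite ρ.ker)
    (α β : ℝ) (hα : 0 < α) (hβ : 0 < β)
    (hG : IsPerfectGrowth α β G) :
    IsPerfectGrowth (α * (Nat.card ρ.ker : ℝ) ^ (1 - 1 / β)) β H := by
  intro K hK S hS hgen
  rcases S.eq_empty_or_nonempty with rfl | hne
  · intro n hn
    have : β * (n : ℝ) ≠ 0 := mul_ne_zero hβ.ne' (by exact_mod_cast (by omega : n ≠ 0))
    simp [Real.zero_rpow this]
  let f := ρ.subgroupComap K
  have hf : Function.Surjective f := ρ.subgroupComap_surjective_of_surjective K hs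
  have e : f.ker ≃ ρ.ker :=
    { toFun := fun x => ⟨x.1.1, congrArg Subtype.val (f.mem_ker.1 x.2)⟩
      invFun := fun x => ⟨⟨x.1, by simp [Subgroup.mem_comap, ρ.mem_ker.1 x.2, K.one_mem]⟩,
        Subtype.ext (ρ.mem_ker.1 x.2)⟩
      left_inv := fun _ => rfl
      right_inv := fun _ => rfl }
  have : Finite f.ker := .of_equiv _ e.symm
  rw [← Nat.card_congr e]
  refine .of_preimage f hf hα hβ hS (hG (K.comap ρ) ?_ _ (f.finite_preimage_of_finite_ker hf hS)
    (f.closure_preimage_eq_top_of_nonempty hf hne hgen))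
  rwa [K.index_comap_of_surjective hs]
end

section
/- For all real numbers α, β > 0 and every integer k ≥ 1 there exist real numbers α', β' > 0, depending only on α, β and k, with the following property: if H is a subgroup of index k in a group G and H is (α,β)-perfect, then G is (α',β')-perfect. -/
open Pointwise

universe u

lemma Set.Finite.product_pow {M : Type*} [Monoid M] {U : Set M} (hU : U.Finite) (n : ℕ) :
    (U ^ n).Finite := by
  classical
  lift U to Finset M using hU
  rw [← Finset.coe_pow]
  exact Finset.finite_toSet _

open scoped Classical in
/-- If `1 ∈ X` in a finite group, the powers of `X` reach the subgroup generated by `X` after at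
most `|P|` steps. -/
lemma Finset.coe_pow_eq_closure_of_card_le {P : Type*} [Group P] [Finite P] {X : Finset P}
    (hX : (1 : P) ∈ X) {D : ℕ} (hD : Nat.card P ≤ D) :
    ((X ^ D : Finset P) : Set P) = Subgroup.closure (X : Set P) := by
  have := Fintype.ofFinite P
  have hsub (n : ℕ) : (X : Set P) ^ n ⊆ Subgroup.closure (X : Set P) := by
    induction n with
    | zero => simp
    | succ n ih =>
      rw [pow_succ]
      rintro _ ⟨a, ha, b, hb, rfl⟩
      exact mul_mem (ih ha) (Subgroup.subset_closure hb)
  rw [Finset.coe_pow]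
  by_contra hne
  obtain rfl | hnt := Finset.eq_singleton_or_nontrivial hX
  · exact hne (by simp [Subgroup.closure_singleton_one])
  have hne' (n : ℕ) (hn : n ≤ D) : (X : Set P) ^ n ≠ Subgroup.closure (X : Set P) := by
    intro h
    refine hne (Set.Subset.antisymm (hsub D) ?_)
    rw [← h]
    exact Set.pow_subset_pow_right (by exact_mod_cast hX) hn
  have hcard (n : ℕ) (hn : n ≤ D) : n + 1 ≤ (X ^ n).card := by
    induction n with
    | zero => simp
    | succ n ih =>
      exact (ih (by omega)).trans_lt <| Finset.card_lt_card <|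
        Finset.pow_ssubset_pow_succ_of_pow_ne_closure hX hnt (by exact_mod_cast hne' n (by omega))
  have h1 := hcard D le_rfl
  have h2 := Finset.card_le_univ (X ^ D)
  rw [Nat.card_eq_fintype_card] at hD
  omega

/-- For a homomorphism to a finite group, the kernel is generated by the part lying in it of a
bounded power of any generating set containing `1`, and this part is not much smaller than the
generating set. -/
lemma MonoidHom.closure_pow_inter_ker {K P : Type*} [Group K] [Group P] [Finite P] (π : K →* P)
    {U : Set K} (hU : U.Finite) (h1 : (1 : K) ∈ U) (hgen : Subgroup.closure U = ⊤) {D : ℕ}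
    (hD : Nat.card P ≤ D) :
    Subgroup.closure (U ^ (2 * D + 1) ∩ π.ker) = π.ker ∧
      U.ncard ≤ (U ^ (2 * D + 1) ∩ π.ker).ncard * D := by
  classical
  have hlift (x : K) : ∃ r ∈ U ^ D, π r = π x := by
    lift U to Finset K using hU
    have hX := Finset.coe_pow_eq_closure_of_card_le (X := U.image π)
      (Finset.mem_image.2 ⟨1, by exact_mod_cast h1, map_one π⟩) hD
    have hx : π x ∈ Subgroup.closure ((U.image π : Finset P) : Set P) := by
      rw [Finset.coe_image, ← MonoidHom.map_closure, hgen]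
      exact ⟨x, trivial, rfl⟩
    rw [← SetLike.mem_coe, ← hX, ← Finset.image_pow] at hx
    simpa [← Finset.coe_pow] using hx
  have hsec : ∃ ρ : P → K, ∀ x, ρ (π x) ∈ U ^ D ∧ π (ρ (π x)) = π x := by
    refine ⟨fun p ↦ if h : ∃ r ∈ U ^ D, π r = p then h.choose else 1, fun x ↦ ?_⟩
    simp only [dif_pos (hlift x)]
    exact (hlift x).choose_spec
  obtain ⟨ρ, hρ⟩ := hsec
  have hρ' (x : K) : ρ (π x)⁻¹ ∈ U ^ D ∧ π (ρ (π x)⁻¹) = (π x)⁻¹ := by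
    simpa using hρ x⁻¹
  set T : Set K := U ^ (2 * D + 1) ∩ π.ker
  have hpow {a b c : K} (ha : a ∈ U ^ D) (hb : b ∈ U) (hc : c ∈ U ^ D) :
      a * b * c ∈ U ^ (2 * D + 1) := by
    rw [show 2 * D + 1 = D + 1 + D by ring, pow_add, pow_add, pow_one]
    exact Set.mul_mem_mul (Set.mul_mem_mul ha hb) hc
  have h1D : (1 : K) ∈ U ^ D := Set.one_mem_pow h1
  refine ⟨le_antisymm ((Subgroup.closure_le _).2 Set.inter_subset_right) fun x hx ↦ ?_, ?_⟩
  · have hstep (x s : K) (hs : s ∈ U) :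
        ρ (π x) * s * (ρ (π (x * s)))⁻¹ ∈ Subgroup.closure T := by
      have e : ρ (π x) * s * (ρ (π (x * s)))⁻¹ =
          (ρ (π x) * s * ρ (π (x * s))⁻¹) * (ρ (π (x * s)) * 1 * ρ (π (x * s))⁻¹)⁻¹ := by group
      rw [e]
      refine mul_mem (Subgroup.subset_closure ⟨hpow (hρ x).1 hs (hρ' (x * s)).1, ?_⟩)
        (inv_mem (Subgroup.subset_closure ⟨hpow (hρ (x * s)).1 h1 (hρ' (x * s)).1, ?_⟩))
      · simp only [SetLike.mem_coe, MonoidHom.mem_ker, map_mul, (hρ x).2]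
        rw [← map_mul, (hρ' (x * s)).2]
        simp
      · simp only [SetLike.mem_coe, MonoidHom.mem_ker, map_mul, map_one]
        rw [← map_mul, (hρ' (x * s)).2, (hρ (x * s)).2]
        simp
    have hone : ρ 1 ∈ Subgroup.closure T := by
      have h := hρ 1
      rw [map_one] at h
      refine Subgroup.subset_closure ⟨?_, h.2⟩
      simpa using hpow h.1 h1 h1D
    have hall (x : K) : x * (ρ (π x))⁻¹ ∈ Subgroup.closure T := by
      have hx : x ∈ Subgroup.closure U := hgen ▸ Subgroup.mem_top x
      induction hx using Subgroup.closure_induction_right with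
      | one => simpa using hone
      | mul_right x _ s hs ih =>
        have := mul_mem ih (hstep x s hs)
        convert this using 1
        group
      | mul_inv_cancel x _ s hs ih =>
        have := mul_mem ih (inv_mem (hstep (x * s⁻¹) s hs))
        rw [inv_mul_cancel_right] at this
        convert this using 1
        group
    have := hall x
    rw [MonoidHom.mem_ker.1 hx] at this
    simpa using mul_mem this hone
  · have hTfin : T.Finite := (hU.product_pow _).inter_of_left _
    have hsub : U ⊆ T * Set.range fun p ↦ (ρ p⁻¹)⁻¹ := by
      intro u hu
      refine Set.mem_mul.2 ⟨u * ρ (π u)⁻¹, ⟨?_, ?_⟩, _, ⟨π u, rfl⟩, by group⟩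
      · simpa using hpow h1D hu (hρ' u).1
      · simp [MonoidHom.mem_ker, (hρ' u).2]
    calc U.ncard ≤ (T * Set.range fun p ↦ (ρ p⁻¹)⁻¹).ncard :=
          Set.ncard_le_ncard hsub (hTfin.mul (Set.finite_range _))
      _ ≤ T.ncard * (Set.range fun p ↦ (ρ p⁻¹)⁻¹).ncard := Set.natCard_mul_le
      _ ≤ T.ncard * D := Nat.mul_le_mul_left _ ((Finite.card_range_le _).trans hD)

open scoped Classical in
/-- Adjoining the identity to a set multiplies the size of its `n`-th power by at most `n + 1`. -/
lemma Finset.card_insert_one_pow_le {K : Type*} [Group K] {S : Finset K} (hS : S.Nonempty)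
    (n : ℕ) : ((insert 1 S) ^ n).card ≤ (n + 1) * (S ^ n).card := by
  have hsub : (insert 1 S) ^ n ⊆ (Finset.range (n + 1)).biUnion (S ^ ·) := by
    induction n with
    | zero => simp
    | succ n ih =>
      intro x hx
      rw [pow_succ] at hx
      obtain ⟨a, ha, b, hb, rfl⟩ := Finset.mem_mul.1 hx
      obtain ⟨i, hi, hai⟩ := Finset.mem_biUnion.1 (ih ha)
      rw [Finset.mem_range] at hi
      rw [Finset.mem_biUnion]
      obtain rfl | hb := Finset.mem_insert.1 hb
      · exact ⟨i, Finset.mem_range.2 (by omega), by simpa using hai⟩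
      · refine ⟨i + 1, Finset.mem_range.2 (by omega), ?_⟩
        simp only [pow_succ]
        exact Finset.mul_mem_mul hai hb
  calc ((insert 1 S) ^ n).card ≤ _ := Finset.card_le_card hsub
    _ ≤ (Finset.range (n + 1)).card * (S ^ n).card :=
        Finset.card_biUnion_le_card_mul _ _ _ fun i hi ↦
          hS.card_pow_mono (by rw [Finset.mem_range] at hi; omega)
    _ = _ := by rw [Finset.card_range]

lemma hasProductSetGrowth_image_iff {G G' : Type*} [Group G] [Group G'] {f : G →* G'}
    (hf : Function.Injective f) {α β : ℝ} {U : Set G} :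
    HasProductSetGrowth α β (f '' U) ↔ HasProductSetGrowth α β U := by
  simp only [HasProductSetGrowth, ← Set.image_pow, Set.ncard_image_of_injective _ hf]

/-- Growth in a perfect subgroup, for generating sets given in the ambient group. -/
lemma IsPerfectGrowth.hasProductSetGrowth {G : Type*} [Group G] {H : Subgroup G} {α β : ℝ}
    (h : IsPerfectGrowth α β H) {T : Set G} (hT : T.Finite) (hTH : Subgroup.closure T ≤ H)
    (hind : (Subgroup.closure T).index ≠ 0) : HasProductSetGrowth α β T := by
  set A := (Subgroup.closure T).subgroupOf H with hA
  have hAi : A.index ≠ 0 := mt Subgroup.index_eq_zero_of_relIndex_eq_zero hind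
  set f : A →* G := H.subtype.comp A.subtype with hf
  have hfi : Function.Injective f := H.subtype_injective.comp A.subtype_injective
  have hTr : f '' (f ⁻¹' T) = T := by
    refine Set.image_preimage_eq_of_subset fun t ht ↦ ?_
    have htA := Subgroup.subset_closure ht
    exact ⟨⟨⟨t, hTH htA⟩, Subgroup.mem_subgroupOf.2 htA⟩, rfl⟩
  have hclo : Subgroup.closure (f ⁻¹' T) = ⊤ := by
    refine Subgroup.map_injective hfi ?_
    rw [MonoidHom.map_closure, hTr, hf, ← Subgroup.map_map, ← MonoidHom.range_eq_map A.subtype,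
      Subgroup.range_subtype, hA, Subgroup.map_subgroupOf_eq_of_le hTH]
  rw [← hTr, hasProductSetGrowth_image_iff hfi]
  exact h A hAi _ (hT.preimage hfi.injOn) hclo

/-- Passing from growth of a subset of a bounded power to growth of the original set. -/
lemma HasProductSetGrowth.of_subset_insert_one_pow {K : Type*} [Group K] {α β : ℝ} (hα : 0 < α)
    (hβ : 0 < β) {D N : ℕ} (hD : 0 < D) (hN : 0 < N) {S T : Set K} (hS : S.Finite)
    (hTS : T ⊆ (insert 1 S) ^ N) (hcard : S.ncard ≤ T.ncard * D)
    (hT : HasProductSetGrowth α β T) :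
    HasProductSetGrowth (min 1 (α / (D * (N + 1 : ℝ) ^ (1 / β)))) (min β 1 / (2 * N)) S := by
  classical
  intro n hn
  set α' := min 1 (α / (D * (N + 1 : ℝ) ^ (1 / β)))
  set β' := min β 1 / (2 * N)
  have hD' : (0 : ℝ) < D := by exact_mod_cast hD
  have hN' : (0 : ℝ) < N := by exact_mod_cast hN
  have hc : (0 : ℝ) < (N + 1 : ℝ) ^ (1 / β) := by positivity
  have hα' : 0 < α' := lt_min one_pos (by positivity)
  have hβ' : 0 < β' := div_pos (lt_min hβ one_pos) (by positivity)
  have hβn : 0 < β' * n := by positivity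
  obtain rfl | hne := S.eq_empty_or_nonempty
  · simp [Real.zero_rpow hβn.ne']
  lift S to Finset K using hS
  have hne : S.Nonempty := by exact_mod_cast hne
  have hmono {i j : ℕ} (h : i ≤ j) : (((S : Set K) ^ i).ncard : ℝ) ≤ ((S : Set K) ^ j).ncard := by
    simp only [← Finset.coe_pow, Set.ncard_coe_finset]
    exact_mod_cast hne.card_pow_mono h
  set a := α' * ((S : Set K).ncard : ℝ) with ha
  have ha0 : 0 ≤ a := by positivity
  have haS : a ≤ (S : Set K).ncard := mul_le_of_le_one_left (by positivity) (min_le_left _ _)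
  rcases le_total a 1 with ha1 | ha1
  · refine (Real.rpow_le_one ha0 ha1 hβn.le).trans ?_
    simpa [← Set.singleton_one] using hmono (Nat.zero_le n)
  rcases lt_or_ge n N with hnN | hnN
  · calc a ^ (β' * n) ≤ a ^ (1 : ℝ) := by
          refine Real.rpow_le_rpow_of_exponent_le ha1 ?_
          have hnN' : (n : ℝ) ≤ N := by exact_mod_cast hnN.le
          rw [div_mul_eq_mul_div, div_le_one (by positivity)]
          nlinarith [min_le_right β 1]
      _ ≤ ((S : Set K) ^ 1).ncard := by simpa using haS
      _ ≤ _ := hmono hn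
  · set m := n / N
    have hm1 : 1 ≤ m := (Nat.one_le_div_iff hN).2 hnN
    have hmn : N * m ≤ n := Nat.mul_div_le n N
    have hn2 : (n : ℝ) ≤ 2 * N * m := by
      have h1 : n < N * m + N := by
        have := Nat.lt_mul_div_succ n hN
        rwa [mul_add, mul_one] at this
      have h2 : n ≤ 2 * N * m := by nlinarith
      exact_mod_cast h2
    have hTm : ((T ^ m).ncard : ℝ) ≤ (N + 1) ^ m * ((S : Set K) ^ n).ncard := by
      have h1 : (T ^ m).ncard ≤ ((insert 1 S) ^ (N * m) : Finset K).card := by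
        rw [← Set.ncard_coe_finset]
        refine Set.ncard_le_ncard ?_ (Finset.finite_toSet _)
        rw [Finset.coe_pow, Finset.coe_insert, pow_mul]
        exact Set.pow_subset_pow_left hTS
      have h2 : N * m + 1 ≤ (N + 1) ^ m := by
        have := one_add_mul_le_pow_of_sq_nonneg (R := ℕ) (a := N) (by simp) (by simp) (by simp) m
        simpa [mul_comm, add_comm] using this
      have h3 := (h1.trans (Finset.card_insert_one_pow_le hne _)).trans
        (Nat.mul_le_mul h2 (hne.card_pow_mono hmn))
      rw [← Finset.coe_pow, Set.ncard_coe_finset]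
      exact_mod_cast h3
    have haT : a * (N + 1 : ℝ) ^ (1 / β) ≤ α * T.ncard := by
      have hcard' : ((S : Set K).ncard : ℝ) ≤ T.ncard * D := by exact_mod_cast hcard
      calc a * (N + 1 : ℝ) ^ (1 / β)
          ≤ α / (D * (N + 1 : ℝ) ^ (1 / β)) * (T.ncard * D) * (N + 1 : ℝ) ^ (1 / β) := by
            rw [ha]
            gcongr
            exact min_le_right _ _
        _ = α * T.ncard := by field_simp
    have hfin : a ^ (β * m) * (N + 1) ^ m ≤ (N + 1) ^ m * ((S : Set K) ^ n).ncard := by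
      calc a ^ (β * m) * (N + 1) ^ m = (a * (N + 1 : ℝ) ^ (1 / β)) ^ (β * m) := by
            rw [Real.mul_rpow ha0 hc.le, ← Real.rpow_mul (by positivity), ← mul_assoc,
              one_div_mul_cancel hβ.ne', one_mul, Real.rpow_natCast]
        _ ≤ (α * T.ncard) ^ (β * m) := by gcongr
        _ ≤ (T ^ m).ncard := hT m hm1
        _ ≤ _ := hTm
    rw [mul_comm] at hfin
    refine le_trans ?_ (le_of_mul_le_mul_left hfin (by positivity))
    refine Real.rpow_le_rpow_of_exponent_le ha1 ?_
    rw [div_mul_eq_mul_div, div_le_iff₀ (by positivity)]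
    calc min β 1 * n ≤ β * (2 * N * m) := by gcongr; exact min_le_left _ _
      _ = _ := by ring

/-- **Lemma 5.6 (PerfectFiniteIndex).** For all `α, β > 0` and `k ≥ 1` there are
`α', β' > 0`, depending only on `α, β, k`, such that whenever `H` is a subgroup of index
`k` in a group `G` and `H` is `(α,β)`-perfect, then `G` is `(α',β')`-perfect. -/
theorem perfectGrowth_of_finiteIndex_subgroup
    (α β : ℝ) (hα : 0 < α) (hβ : 0 < β) (k : ℕ) (hk : 1 ≤ k) :
    ∃ α' β' : ℝ, 0 < α' ∧ 0 < β' ∧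
      ∀ (G : Type u) [Group G] (H : Subgroup G), H.index = k →
        IsPerfectGrowth α β H → IsPerfectGrowth α' β' G := by
  have hD : 0 < k.factorial := k.factorial_pos
  set N := 2 * k.factorial + 1
  refine ⟨min 1 (α / (k.factorial * ((N : ℝ) + 1) ^ (1 / β))), min β 1 / (2 * N),
    lt_min one_pos (by positivity), div_pos (lt_min hβ one_pos) (by positivity), ?_⟩
  intro G _ H hH hperf K hK S hS hgen
  have : H.FiniteIndex := ⟨by omega⟩
  set π : K →* Equiv.Perm (G ⧸ H) := (MulAction.toPermHom G (G ⧸ H)).comp K.subtype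
  have hcardP : Nat.card (Equiv.Perm (G ⧸ H)) ≤ k.factorial := by
    rw [Nat.card_perm, ← Subgroup.index_eq_card, hH]
  have hU : (insert 1 S).Finite := hS.insert 1
  have hgenU : Subgroup.closure (insert 1 S) = ⊤ :=
    top_le_iff.1 (hgen.ge.trans (Subgroup.closure_mono (Set.subset_insert _ _)))
  obtain ⟨hclo, hcard⟩ := π.closure_pow_inter_ker hU (Set.mem_insert _ _) hgenU hcardP
  refine HasProductSetGrowth.of_subset_insert_one_pow hα hβ hD (Nat.succ_pos _) hS
    Set.inter_subset_left ((Set.ncard_le_ncard (Set.subset_insert 1 S) hU).trans hcard) ?_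
  rw [← hasProductSetGrowth_image_iff K.subtype_injective]
  have hcl : Subgroup.closure (K.subtype '' ((insert 1 S) ^ N ∩ π.ker)) =
      π.ker.map K.subtype := by
    rw [← MonoidHom.map_closure, hclo]
  refine hperf.hasProductSetGrowth (((hU.product_pow N).inter_of_left _).image _) ?_ ?_
  · rw [hcl]
    rintro _ ⟨x, hx, rfl⟩
    refine H.normalCore_le ?_
    rw [Subgroup.normalCore_eq_ker]
    exact hx
  · rw [hcl, Subgroup.index_map_subtype]
    refine mul_ne_zero ?_ hK
    rw [Subgroup.index_ker]
    exact Nat.card_pos.ne'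
end

section
/- For every integer N ≥ 1, setting k = (2N+1)² − 1, there exist elements g, h ∈ ℤ^k such that: (i) for every coordinate index i ∈ {1,…,k}, at least one of g_i, h_i is nonzero (so the subgroup generated by g and h has full support in ℤ^k); yet (ii) for all integers m, n with |m| ≤ N and |n| ≤ N, the element m·g + n·h has at least one zero coordinate (so it does not have full support). -/
/-- **Example 4.3.** For every `N ≥ 1`, with `k = (2N+1)² − 1`, there are `g, h ∈ ℤ^k`
such that every coordinate is nonzero on at least one of `g, h` (so `⟨g,h⟩` has full
support), yet for all integers `m, n` with `|m| ≤ N` and `|n| ≤ N` the element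
`m·g + n·h` has at least one zero coordinate. -/
theorem abelian_support_cannot_be_combined_quickly (N : ℕ) (hN : 1 ≤ N) :
    ∃ g h : Fin ((2 * N + 1) ^ 2 - 1) → ℤ,
      (∀ i, g i ≠ 0 ∨ h i ≠ 0) ∧
      ∀ m n : ℤ, |m| ≤ (N : ℤ) → |n| ≤ (N : ℤ) →
        ∃ i, m * g i + n * h i = 0 := by
  classical
  let s : Finset (ℤ × ℤ) := (Finset.Icc (-(N : ℤ)) N ×ˢ Finset.Icc (-(N : ℤ)) N).erase 0
  have hmem {m n : ℤ} : (m, n) ∈ s ↔ (m, n) ≠ 0 ∧ |m| ≤ (N : ℤ) ∧ |n| ≤ (N : ℤ) := by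
    simp [s, abs_le]
  have hcard : s.card = (2 * N + 1) ^ 2 - 1 := by
    have hside : ((N : ℤ) + 1 - -(N : ℤ)).toNat = 2 * N + 1 := by omega
    rw [Finset.card_erase_of_mem (by simp), Finset.card_product, Int.card_Icc, hside, sq]
  let e := s.equivFinOfCardEq hcard
  refine ⟨fun i => (e.symm i).1.2, fun i => -(e.symm i).1.1, fun i => ?_, fun m n hm hn => ?_⟩
  · by_contra! h
    exact (hmem.mp (e.symm i).2).1 (Prod.ext (neg_eq_zero.mp h.2) h.1)
  · by_cases h : (m, n) = 0
    · obtain ⟨rfl, rfl⟩ := Prod.mk.inj h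
      exact ⟨e ⟨(1, 0), hmem.mpr ⟨by simp, by simpa using hN, by simp⟩⟩, by simp⟩
    · refine ⟨e ⟨(m, n), hmem.mpr ⟨h, hm, hn⟩⟩, ?_⟩
      simp only [Equiv.symm_apply_apply]
      ring
end

section
/- Let G be a group, let m ≥ 1 be an integer, let p_1, …, p_m : G → ℤ be group homomorphisms (to the additive group of integers), and let u_1, …, u_m ∈ G be elements such that p_i(u_i) ≠ 0 for every i ∈ {1,…,m}. Then there exist positive integers n_1, …, n_m with n_j ≤ j+1 for every j, such that p_i(u_1^{n_1} · u_2^{n_2} ⋯ u_m^{n_m}) ≠ 0 for every i ∈ {1,…,m}. In particular, the resulting element is a product of at most (m+1)(m+2)/2 of the elements u_1, …, u_m. -/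
/-- Finitely many affine functions `k ↦ s i + k * a i` on `ℤ`, none of them identically zero, have
a common nonroot among any `card ι + 1` consecutive integers starting from `1`. -/
theorem exists_nat_forall_add_mul_ne_zero {ι : Type*} [Fintype ι] (s a : ι → ℤ)
    (h : ∀ i, s i ≠ 0 ∨ a i ≠ 0) :
    ∃ k : ℕ, 1 ≤ k ∧ k ≤ Fintype.card ι + 1 ∧ ∀ i, s i + k * a i ≠ 0 := by
  by_contra! hcon
  choose f hf using fun k : Fin (Fintype.card ι + 1) =>
    hcon (k + 1) (Nat.le_add_left 1 k) (Nat.succ_le_of_lt k.isLt)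
  obtain ⟨k, l, hkl, hfkl⟩ := Fintype.exists_ne_map_eq_of_card_lt f (by simp)
  have hk := hf k
  have hl := hf l
  rw [← hfkl] at hl
  push_cast at hk hl
  have hne : ((k : ℕ) : ℤ) - ((l : ℕ) : ℤ) ≠ 0 := by
    have := Fin.val_ne_of_ne hkl
    omega
  have ha : a (f k) = 0 :=
    (mul_eq_zero.mp (by linear_combination hk - hl :
      (((k : ℕ) : ℤ) - ((l : ℕ) : ℤ)) * a (f k) = 0)).resolve_left hne
  have hs : s (f k) = 0 := by simpa [ha] using hk
  exact (h (f k)).elim (· hs) (· ha)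

/-- A square integer matrix with nonzero diagonal entries maps some vector with small positive
entries to a vector with nonzero entries. -/
theorem exists_nat_forall_sum_mul_ne_zero (m : ℕ) (a : Fin m → Fin m → ℤ)
    (ha : ∀ i, a i i ≠ 0) :
    ∃ n : Fin m → ℕ, (∀ j : Fin m, 1 ≤ n j ∧ n j ≤ (j : ℕ) + 2) ∧
      ∀ i, ∑ j, (n j : ℤ) * a i j ≠ 0 := by
  induction m with
  | zero => exact ⟨Fin.elim0, fun j => j.elim0, fun i => i.elim0⟩
  | succ m ih =>
    obtain ⟨n, hn, hsum⟩ := ih (fun i j => a i.castSucc j.castSucc) fun i => ha i.castSucc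
    obtain ⟨k, hk1, hk2, hk⟩ := exists_nat_forall_add_mul_ne_zero
      (fun i : Fin (m + 1) => ∑ j : Fin m, (n j : ℤ) * a i j.castSucc)
      (fun i => a i (Fin.last m))
      (Fin.lastCases (Or.inr (ha _)) fun i => Or.inl (hsum i))
    refine ⟨Fin.snoc (α := fun _ => ℕ) n k, fun j => ?_, fun i => ?_⟩
    · cases j using Fin.lastCases with
      | last => simpa using And.intro hk1 hk2
      | cast j => simpa using hn j
    · simpa [Fin.sum_univ_castSucc] using hk i

theorem sum_fin_add_two_le (m : ℕ) :
    ∑ j : Fin m, ((j : ℕ) + 2) ≤ (m + 1) * (m + 2) / 2 := by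
  rw [Nat.le_div_iff_mul_le two_pos]
  induction m with
  | zero => simp
  | succ m ih =>
    rw [Fin.sum_univ_castSucc]
    simp only [Fin.val_castSucc, Fin.val_last]
    linarith


/-- **Core claim of Proposition A.4 (ThomasCarolyn2).** Let `G` be a group, `m ≥ 1`, and
let `p_1, …, p_m : G → ℤ` be homomorphisms to the additive integers, with elements
`u_1, …, u_m ∈ G` satisfying `p_i(u_i) ≠ 0`. Then there are positive integers
`n_1, …, n_m` with `n_j ≤ j + 1` (for the `j`-th index, `1`-indexed) such that
`p_i(u_1^{n_1} ⋯ u_m^{n_m}) ≠ 0` for every `i`; in particular the resulting element is a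
product of at most `(m+1)(m+2)/2` of the `u_j`. -/
theorem short_product_with_nonzero_projections {G : Type*} [Group G]
    (m : ℕ) (hm : 1 ≤ m)
    (p : Fin m → G → ℤ)
    (hp : ∀ i, ∀ a b : G, p i (a * b) = p i a + p i b)
    (u : Fin m → G) (hu : ∀ i, p i (u i) ≠ 0) :
    ∃ n : Fin m → ℕ,
      (∀ j : Fin m, 1 ≤ n j ∧ n j ≤ (j : ℕ) + 2) ∧
      (∑ j, n j) ≤ (m + 1) * (m + 2) / 2 ∧
      ∀ i, p i (((List.finRange m).map (fun j => u j ^ n j)).prod) ≠ 0 := by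
  obtain ⟨n, hn, hsum⟩ := exists_nat_forall_sum_mul_ne_zero m (fun i j => p i (u j)) hu
  refine ⟨n, hn, (Finset.sum_le_sum fun j _ => (hn j).2).trans (sum_fin_add_two_le m),
    fun i => ?_⟩
  let φ : G →* Multiplicative ℤ :=
    MonoidHom.mk' (fun g => Multiplicative.ofAdd (p i g)) fun a b => by simp [hp]
  have key : p i (((List.finRange m).map (fun j => u j ^ n j)).prod) =
      ∑ j, (n j : ℤ) * p i (u j) := by
    change (φ _).toAdd = _
    rw [map_list_prod, List.map_map, ← List.ofFn_eq_map, List.prod_ofFn, toAdd_prod]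
    simp only [Function.comp_apply, map_pow, toAdd_pow, nsmul_eq_mul]
    rfl
  rw [key]
  exact hsum i
end
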